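/- arXiv:math/0609019 — 6 statements merged into one kernel-verified Lean document; each statement's English description precedes it below -/
import Mathlib

section
/- Let A ∈ ℤ^{m×n}, b ∈ ℤ^m, and suppose the set S = {x ∈ ℕ^n : Ax = b} is nonempty and finite, and let P = conv(S). Let w_1,…,w_d ∈ ℤ^n and let W : ℝ^n → ℝ^d be the linear map x ↦ (w_1·x,…,w_d·x). Let E ⊂ ℤ^n be a finite set covering all edge-directions of P, let D = {W e : e ∈ E}, and let Z = zone(D) ⊂ ℝ^d. Suppose that for each vertex v of Z we are given g_v ∈ ℝ^d that is uniquely maximized over Z at v, and a point x_v ∈ S maximizing the linear function x ↦ g_v·(W x) over S. Then for every convex function c : ℝ^d → ℝ, the maximum of c(W x) over x ∈ S equals the maximum of c(W x_v) over the vertices v of Z. -/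
open Matrix

noncomputable section

/-- Coordinatewise cast of an integer vector to a real vector. -/
def intCast {n : ℕ} (z : Fin n → ℤ) : Fin n → ℝ := fun i => (z i : ℝ)

/-- The set of nonnegative integer solutions of `Ax = b`, viewed inside `ℝ^n`. -/
def feasSet {m n : ℕ} (A : Matrix (Fin m) (Fin n) ℤ) (b : Fin m → ℤ) : Set (Fin n → ℝ) :=
  {x | ∃ y : Fin n → ℕ, x = (fun i => ((y i : ℝ))) ∧ A.mulVec (fun i => ((y i : ℤ))) = b}

/-- `e` is an edge (one-dimensional face) of `P`. -/
def IsEdge {k : ℕ} (P e : Set (Fin k → ℝ)) : Prop :=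
  (∃ w : Fin k → ℝ, e = {x | x ∈ P ∧ ∀ y ∈ P, w ⬝ᵥ y ≤ w ⬝ᵥ x}) ∧
    Module.finrank ℝ ↥(vectorSpan ℝ e) = 1

/-- The zonotope generated by a finite set `E`. -/
def zone {k : ℕ} (E : Finset (Fin k → ℝ)) : Set (Fin k → ℝ) :=
  convexHull ℝ {z | ∃ ε : (Fin k → ℝ) → ℝ, (∀ e, ε e = 1 ∨ ε e = -1) ∧ z = ∑ e ∈ E, ε e • e}

/-- The linear functional `w` is uniquely maximized over `Z` at `v`. -/
def UniqueMax {k : ℕ} (Z : Set (Fin k → ℝ)) (w v : Fin k → ℝ) : Prop :=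
  v ∈ Z ∧ ∀ z ∈ Z, z ≠ v → w ⬝ᵥ z < w ⬝ᵥ v

/-- `v` is a vertex of `Z`: some linear functional is uniquely maximized over `Z` at `v`. -/
def IsVertex {k : ℕ} (Z : Set (Fin k → ℝ)) (v : Fin k → ℝ) : Prop :=
  ∃ w, UniqueMax Z w v

/-- If every point of `T` satisfies `l s ≤ a`, with equality only on the fibre `L s = y`,
then the same holds on the convex hull of `T`. -/
lemma convexHull_le_and_eq_imp {E F : Type*} [AddCommGroup E] [Module ℝ E] [AddCommGroup F]
    [Module ℝ F] (l : E →ₗ[ℝ] ℝ) (L : E →ₗ[ℝ] F) (a : ℝ) (y : F) {T : Set E}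
    (h : ∀ s ∈ T, l s ≤ a ∧ (l s = a → L s = y)) {z : E} (hz : z ∈ convexHull ℝ T) :
    l z ≤ a ∧ (l z = a → L z = y) := by
  have hK : Convex ℝ {z : E | l z ≤ a ∧ (l z = a → L z = y)} := by
    rintro p ⟨hp, hp'⟩ q ⟨hq, hq'⟩ s t hs ht hst
    simp only [Set.mem_ofPred_eq, map_add, map_smul, smul_eq_mul]
    have hp0 := mul_nonneg hs (sub_nonneg.2 hp)
    have hq0 := mul_nonneg ht (sub_nonneg.2 hq)
    have hsum : s * (a - l p) + t * (a - l q) = a - (s * l p + t * l q) := by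
      linear_combination a * hst
    refine ⟨by linarith, fun heq => ?_⟩
    have h1 : s * (a - l p) = 0 := by linarith
    have h2 : t * (a - l q) = 0 := by linarith
    have h1' : s • L p = s • y := by
      rcases mul_eq_zero.1 h1 with h | h
      · simp [h]
      · rw [hp' (by linarith)]
    have h2' : t • L q = t • y := by
      rcases mul_eq_zero.1 h2 with h | h
      · simp [h]
      · rw [hq' (by linarith)]
    rw [h1', h2', ← add_smul, hst, one_smul]
  exact convexHull_min h hK hz

/-- A finite set has a subset of strictly exposed points with the same convex hull. -/
lemma exists_exposed_subset {E : Type*} [NormedAddCommGroup E] [NormedSpace ℝ E] (T : Finset E) :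
    ∃ T' ⊆ T, (T : Set E) ⊆ convexHull ℝ (T' : Set E) ∧
      ∀ v ∈ T', ∃ l : E →ₗ[ℝ] ℝ, ∀ t ∈ T, t ≠ v → l t < l v := by
  classical
  obtain ⟨T', hT', hmin⟩ := Finset.exists_min_image
    (T.powerset.filter fun U : Finset E => (T : Set E) ⊆ convexHull ℝ (U : Set E)) Finset.card
    ⟨T, by simp [subset_convexHull]⟩
  simp only [Finset.mem_filter, Finset.mem_powerset] at hT' hmin
  refine ⟨T', hT'.1, hT'.2, fun v hv => ?_⟩
  have hnot : v ∉ convexHull ℝ ((T'.erase v : Finset E) : Set E) := by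
    intro hmem
    refine absurd (hmin (T'.erase v) ⟨(Finset.erase_subset _ _).trans hT'.1, ?_⟩)
      (not_le.2 (Finset.card_erase_lt_of_mem hv))
    refine hT'.2.trans (convexHull_min (fun t ht => ?_) (convex_convexHull ℝ _))
    by_cases htv : t = v
    · exact htv ▸ hmem
    · exact subset_convexHull ℝ _ (by simpa [htv] using ht)
  obtain ⟨f, u, hfu, huv⟩ := geometric_hahn_banach_closed_point (convex_convexHull ℝ _)
    ((T'.erase v).finite_toSet.isClosed_convexHull ℝ) hnot
  refine ⟨f.toLinearMap, fun t ht htv => ?_⟩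
  have key := convexHull_le_and_eq_imp f.toLinearMap LinearMap.id (f v) v (T := (T' : Set E))
    (fun s hs => by
      by_cases hsv : s = v
      · simp [hsv]
      · have := (hfu s (subset_convexHull ℝ _ (by simpa [hsv] using hs))).trans huv
        exact ⟨this.le, fun h => absurd h this.ne⟩) (hT'.2 ht)
  exact lt_of_le_of_ne key.1 fun h => htv (key.2 h)

lemma exists_eq_dotProduct {k : ℕ} (l : (Fin k → ℝ) →ₗ[ℝ] ℝ) :
    ∃ w : Fin k → ℝ, ∀ z, l z = w ⬝ᵥ z :=
  ⟨(dotProductEquiv ℝ (Fin k)).symm l, fun z => by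
    conv_lhs => rw [← (dotProductEquiv ℝ (Fin k)).apply_symm_apply l]
    rfl⟩

/-- The cone of a polytope at a strictly exposed vertex `x` is generated by edge directions. -/
lemma exists_edge_generators {k : ℕ} (S : Finset (Fin k → ℝ)) {x : Fin k → ℝ} (hx : x ∈ S)
    (f : (Fin k → ℝ) →ₗ[ℝ] ℝ) (hf : ∀ s ∈ S, s ≠ x → f s < f x) :
    ∃ T : Set (Fin k → ℝ),
      (∀ s ∈ S, s ≠ x → (f x - f s)⁻¹ • (s - x) ∈ convexHull ℝ T) ∧
      ∀ p ∈ T, (∃ s ∈ S, s ≠ x ∧ p = (f x - f s)⁻¹ • (s - x)) ∧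
        ∃ e, IsEdge (convexHull ℝ (S : Set (Fin k → ℝ))) e ∧
          ∀ u ∈ e, ∀ v ∈ e, ∃ r : ℝ, u - v = r • p := by
  classical
  obtain ⟨T, hTsub, hThull, hTexp⟩ := exists_exposed_subset
    ((S.erase x).image fun s => (f x - f s)⁻¹ • (s - x))
  refine ⟨T, fun s hs hsx => hThull ?_, fun p hp => ?_⟩
  · simp only [Finset.coe_image]
    exact ⟨s, by simp [hs, hsx], rfl⟩
  obtain ⟨s, hs, rfl⟩ := Finset.mem_image.1 (hTsub hp)
  obtain ⟨hsx, hsS⟩ := Finset.mem_erase.1 hs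
  refine ⟨⟨s, hsS, hsx, rfl⟩, ?_⟩
  obtain ⟨l, hl⟩ := hTexp _ hp
  set p := (f x - f s)⁻¹ • (s - x) with hpdef
  have hpos : 0 < f x - f s := sub_pos.2 (hf s hsS hsx)
  have hsp : s - x = (f x - f s) • p := by rw [hpdef, smul_inv_smul₀ hpos.ne']
  have hp0 : p ≠ 0 := by
    intro h
    rw [h, smul_zero, sub_eq_zero] at hsp
    exact hsx hsp
  set φ : (Fin k → ℝ) →ₗ[ℝ] ℝ := l + l p • f with hφ
  have hfp : f p = -1 := by
    rw [hpdef, map_smul, map_sub, smul_eq_mul]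
    field_simp
    ring
  have hφp : φ p = 0 := by simp [hφ, hfp]
  have hφs : φ s = φ x := by
    have := congrArg φ hsp
    rw [map_sub, map_smul, hφp, smul_zero] at this
    linarith
  obtain ⟨w, hw⟩ := exists_eq_dotProduct φ
  have hface : ∀ z ∈ convexHull ℝ (S : Set (Fin k → ℝ)),
      φ z ≤ φ x ∧ (φ z = φ x → (ℝ ∙ p).mkQ z = (ℝ ∙ p).mkQ x) := by
    intro z hz
    refine convexHull_le_and_eq_imp φ _ _ _ (fun t ht => ?_) hz
    by_cases htx : t = x
    · simp [htx]
    have htpos : 0 < f x - f t := sub_pos.2 (hf t ht htx)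
    set q := (f x - f t)⁻¹ • (t - x) with hqdef
    have htq : t - x = (f x - f t) • q := by rw [hqdef, smul_inv_smul₀ htpos.ne']
    have hfq : f q = -1 := by
      rw [hqdef, map_smul, map_sub, smul_eq_mul]
      field_simp
      ring
    have hφq : φ q = l q - l p := by simp [hφ, hfq]; ring
    have hφt : φ t - φ x = (f x - f t) * (l q - l p) := by
      rw [← map_sub, htq, map_smul, hφq, smul_eq_mul]
    by_cases hqp : q = p
    · rw [hqp, sub_self, mul_zero] at hφt
      refine ⟨by linarith, fun _ => ?_⟩
      rw [← sub_eq_zero, ← map_sub, htq, hqp]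
      simp
    · have hlt : l q < l p :=
        hl q (Finset.mem_image.2 ⟨t, by simp [htx, Finset.mem_coe.1 ht], rfl⟩) hqp
      have : φ t < φ x := by nlinarith
      exact ⟨this.le, fun h => absurd h this.ne⟩
  have hxP : x ∈ convexHull ℝ (S : Set (Fin k → ℝ)) := subset_convexHull ℝ _ hx
  have hsP : s ∈ convexHull ℝ (S : Set (Fin k → ℝ)) := subset_convexHull ℝ _ hsS
  have hdiff : ∀ u ∈ {z | z ∈ convexHull ℝ (S : Set (Fin k → ℝ)) ∧
      ∀ y ∈ convexHull ℝ (S : Set (Fin k → ℝ)), w ⬝ᵥ y ≤ w ⬝ᵥ z},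
      (ℝ ∙ p).mkQ u = (ℝ ∙ p).mkQ x := by
    rintro u ⟨huP, hu⟩
    have h1 := hface u huP
    refine h1.2 (le_antisymm h1.1 ?_)
    rw [hw, hw]
    exact hu x hxP
  refine ⟨{z | z ∈ convexHull ℝ (S : Set (Fin k → ℝ)) ∧
      ∀ y ∈ convexHull ℝ (S : Set (Fin k → ℝ)), w ⬝ᵥ y ≤ w ⬝ᵥ z}, ⟨⟨w, rfl⟩, ?_⟩, ?_⟩
  · rw [← finrank_span_singleton (K := ℝ) hp0]
    refine congrArg (fun V : Submodule ℝ (Fin k → ℝ) => Module.finrank ℝ V) ?_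
    refine le_antisymm (Submodule.span_le.2 ?_) ?_
    · rintro _ ⟨u, hu, v, hv, rfl⟩
      exact (Submodule.Quotient.eq _).1 ((hdiff u hu).trans (hdiff v hv).symm)
    · rw [Submodule.span_singleton_le_iff_mem, hpdef, ← vsub_eq_sub]
      refine Submodule.smul_mem _ _ (vsub_mem_vectorSpan ℝ ⟨hsP, fun y hy => ?_⟩
        ⟨hxP, fun y hy => ?_⟩)
      · rw [← hw, ← hw, hφs]
        exact (hface y hy).1
      · rw [← hw, ← hw]
        exact (hface y hy).1
  · intro u hu v hv
    have := (Submodule.Quotient.eq _).1 ((hdiff u hu).trans (hdiff v hv).symm)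
    obtain ⟨r, hr⟩ := Submodule.mem_span_singleton.1 this
    exact ⟨r, hr.symm⟩

/-- A functional with no zero among the nonzero generators has a unique maximizer
over the zonotope. -/
lemma uniqueMax_zone_sum_sign {d : ℕ} (D : Finset (Fin d → ℝ)) (h : Fin d → ℝ)
    (hh : ∀ δ ∈ D, δ ≠ 0 → h ⬝ᵥ δ ≠ 0) :
    UniqueMax (zone D) h (∑ δ ∈ D, (if 0 ≤ h ⬝ᵥ δ then (1 : ℝ) else -1) • δ) := by
  refine ⟨subset_convexHull ℝ _ ⟨fun δ => if 0 ≤ h ⬝ᵥ δ then 1 else -1,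
    fun δ => by dsimp only; split_ifs <;> simp, rfl⟩, fun z hz hzv => ?_⟩
  set v := ∑ δ ∈ D, (if 0 ≤ h ⬝ᵥ δ then (1 : ℝ) else -1) • δ with hv
  have key := convexHull_le_and_eq_imp (dotProductEquiv ℝ (Fin d) h) LinearMap.id (h ⬝ᵥ v) v
    (fun s hs => ?_) hz
  · exact lt_of_le_of_ne key.1 fun e => hzv (key.2 e)
  obtain ⟨ε, hε, rfl⟩ := hs
  have hterm : ∀ δ ∈ D, h ⬝ᵥ (ε δ • δ) ≤ h ⬝ᵥ ((if 0 ≤ h ⬝ᵥ δ then (1 : ℝ) else -1) • δ) := by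
    intro δ _
    rw [dotProduct_smul, dotProduct_smul, smul_eq_mul, smul_eq_mul]
    rcases hε δ with e | e <;> split_ifs <;> rw [e] <;> linarith
  simp only [dotProductEquiv_apply_apply, LinearMap.id_apply]
  rw [hv, dotProduct_sum, dotProduct_sum]
  refine ⟨Finset.sum_le_sum hterm, fun heq => Finset.sum_congr rfl fun δ hδ => ?_⟩
  have h1 := (Finset.sum_eq_sum_iff_of_le hterm).1 heq δ hδ
  by_cases h0 : δ = 0
  · simp [h0]
  · rw [dotProduct_smul, dotProduct_smul, smul_eq_mul, smul_eq_mul] at h1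
    rw [mul_right_cancel₀ (hh δ hδ h0) h1]

/-- Functionals uniquely maximized at the sign vertex have the prescribed signs. -/
lemma sign_of_uniqueMax_zone {d : ℕ} (D : Finset (Fin d → ℝ)) (g : Fin d → ℝ)
    (ε : (Fin d → ℝ) → ℝ) (hε : ∀ δ, ε δ = 1 ∨ ε δ = -1)
    (hg : UniqueMax (zone D) g (∑ δ ∈ D, ε δ • δ)) {δ : Fin d → ℝ} (hδ : δ ∈ D) (h0 : δ ≠ 0) :
    0 < ε δ * (g ⬝ᵥ δ) := by
  classical
  have hflip : ∑ γ ∈ D, (Function.update ε δ (-ε δ)) γ • γ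
      = ∑ γ ∈ D, ε γ • γ - (2 * ε δ) • δ := by
    rw [← Finset.add_sum_erase D _ hδ, ← Finset.add_sum_erase D (fun γ => ε γ • γ) hδ,
      Finset.sum_congr rfl fun γ hγ => by
        rw [Function.update_of_ne (Finset.ne_of_mem_erase hγ)], Function.update_self]
    module
  have hne : ε δ ≠ 0 := by rcases hε δ with e | e <;> rw [e] <;> norm_num
  have := hg.2 (∑ γ ∈ D, (Function.update ε δ (-ε δ)) γ • γ)
    (subset_convexHull ℝ _ ⟨_, fun γ => ?_, rfl⟩) ?_
  · rw [hflip, dotProduct_sub, dotProduct_smul, smul_eq_mul] at this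
    linarith
  · by_cases hγ : γ = δ
    · subst hγ
      rcases hε γ with e | e <;> simp [e]
    · simpa [hγ] using hε γ
  · rw [hflip]
    intro h
    rw [sub_eq_self] at h
    exact smul_ne_zero (mul_ne_zero two_ne_zero hne) h0 h

/-- A strict maximizer over a finite set stays strict for some functional that is nonzero on
prescribed nonzero vectors. -/
lemma exists_generic_functional {d : ℕ} (D U : Finset (Fin d → ℝ)) (u : Fin d → ℝ)
    (l : (Fin d → ℝ) →ₗ[ℝ] ℝ) (hl : ∀ t ∈ U, t ≠ u → l t < l u) :
    ∃ h : Fin d → ℝ, (∀ δ ∈ D, δ ≠ 0 → h ⬝ᵥ δ ≠ 0) ∧ ∀ t ∈ U, t ≠ u → h ⬝ᵥ t < h ⬝ᵥ u := by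
  classical
  obtain ⟨r, hr⟩ := Module.exists_dual_forall_apply_ne_zero (K := ℝ)
    (fun δ : {δ // δ ∈ D.erase 0} => (δ : Fin d → ℝ))
    (fun δ => (Finset.mem_erase.1 δ.2).1)
  have h1 : ∀ᶠ t : ℝ in nhdsWithin 0 (Set.Ioi 0), ∀ δ ∈ D.erase 0, l δ + t * r δ ≠ 0 := by
    rw [Filter.eventually_all_finset]
    intro δ hδ
    have hrδ : r δ ≠ 0 := hr ⟨δ, hδ⟩
    by_cases h0 : l δ = 0
    · filter_upwards [self_mem_nhdsWithin] with t ht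
      rw [h0, zero_add]
      exact mul_ne_zero (ne_of_gt ht) hrδ
    · refine Filter.Eventually.filter_mono nhdsWithin_le_nhds ?_
      have : Continuous fun t : ℝ => l δ + t * r δ := by fun_prop
      exact this.continuousAt.eventually_ne (by simpa using h0)
  have h2 : ∀ᶠ t : ℝ in nhdsWithin 0 (Set.Ioi 0), ∀ z ∈ U.erase u,
      l z + t * r z < l u + t * r u := by
    rw [Filter.eventually_all_finset]
    intro z hz
    refine Filter.Eventually.filter_mono nhdsWithin_le_nhds ?_
    have ha : Continuous fun t : ℝ => l z + t * r z := by fun_prop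
    have hb : Continuous fun t : ℝ => l u + t * r u := by fun_prop
    refine ha.continuousAt.eventually_lt hb.continuousAt ?_
    simpa using hl z (Finset.mem_of_mem_erase hz) (Finset.ne_of_mem_erase hz)
  obtain ⟨t, ht1, ht2⟩ := (h1.and h2).exists
  obtain ⟨h, hh⟩ := exists_eq_dotProduct (l + t • r)
  refine ⟨h, fun δ hδ h0 => ?_, fun z hz hzu => ?_⟩
  · rw [← hh]
    exact ht1 δ (Finset.mem_erase.2 ⟨h0, hδ⟩)
  · rw [← hh, ← hh]
    exact ht2 z (Finset.mem_erase.2 ⟨hzu, hz⟩)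

/-- If `g` agrees in sign with `h` along the images of directions covering the edges of
`conv S`, then every maximizer of `g ∘ L` over `S` is mapped by `L` to the strict maximizer
`u` of `h` over `L '' S`. -/
lemma map_maximizer_eq {k d : ℕ} (S : Finset (Fin k → ℝ)) (L : (Fin k → ℝ) →ₗ[ℝ] (Fin d → ℝ))
    (E : Set (Fin k → ℝ))
    (hE : ∀ e, IsEdge (convexHull ℝ (S : Set (Fin k → ℝ))) e →
      ∃ a ∈ E, ∃ u ∈ e, ∃ v ∈ e, u ≠ v ∧ ∃ lam : ℝ, lam ≠ 0 ∧ a = lam • (u - v))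
    (g h : Fin d → ℝ) (hgh : ∀ a ∈ E, L a ≠ 0 → 0 < (h ⬝ᵥ L a) * (g ⬝ᵥ L a))
    {x₀ : Fin k → ℝ} (hx₀ : x₀ ∈ S) (hu : ∀ s ∈ S, L s ≠ L x₀ → h ⬝ᵥ L s < h ⬝ᵥ L x₀)
    {y : Fin k → ℝ} (hy : y ∈ S) (hymax : ∀ s ∈ S, g ⬝ᵥ L s ≤ g ⬝ᵥ L y) :
    L y = L x₀ := by
  have hle : ∀ s ∈ S, h ⬝ᵥ L s ≤ h ⬝ᵥ L x₀ := fun s hs => by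
    by_cases e : L s = L x₀
    · rw [e]
    · exact (hu s hs e).le
  obtain ⟨T, hTS, hThull, hTexp⟩ := exists_exposed_subset S
  obtain ⟨x, hxT, hx⟩ := (((dotProductEquiv ℝ (Fin d) h) ∘ₗ L).convexOn
    convex_univ).exists_ge_of_mem_convexHull (Set.subset_univ _) (hThull hx₀)
  simp only [LinearMap.comp_apply, dotProductEquiv_apply_apply] at hx
  have hxS : x ∈ S := hTS hxT
  have hLx : L x = L x₀ := by
    by_contra e
    exact absurd hx (not_le.2 (hu x hxS e))
  obtain ⟨f, hf⟩ := hTexp x hxT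
  obtain ⟨R, hR, hRedge⟩ := exists_edge_generators S hxS f hf
  rw [← hLx]
  by_cases hyx : y = x
  · rw [hyx]
  have hpos : 0 < f x - f y := sub_pos.2 (hf y hy hyx)
  have key := convexHull_le_and_eq_imp ((dotProductEquiv ℝ (Fin d) g) ∘ₗ L) L 0 0
    (fun p hp => ?_) (hR y hy hyx)
  · simp only [LinearMap.comp_apply, dotProductEquiv_apply_apply, map_smul, map_sub,
      smul_eq_mul] at key
    have h1 := hymax x hxS
    have h2 : (f x - f y)⁻¹ * (g ⬝ᵥ L y - g ⬝ᵥ L x) = 0 :=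
      le_antisymm key.1 (mul_nonneg (inv_pos.2 hpos).le (sub_nonneg.2 h1))
    have h3 := key.2 h2
    rw [smul_eq_zero] at h3
    exact sub_eq_zero.1 (h3.resolve_left (inv_pos.2 hpos).ne')
  obtain ⟨⟨s, hs, hsx, hps⟩, e, he, hline⟩ := hRedge p hp
  obtain ⟨a, ha, u, hue, v, hve, huv, lam, hlam, rfl⟩ := hE e he
  obtain ⟨r, hr⟩ := hline u hue v hve
  have hr0 : r ≠ 0 := by
    rintro rfl
    rw [zero_smul, sub_eq_zero] at hr
    exact huv hr
  simp only [LinearMap.comp_apply, dotProductEquiv_apply_apply]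
  by_cases hp0 : L p = 0
  · simp [hp0]
  have hmu : lam * r ≠ 0 := mul_ne_zero hlam hr0
  have hLa : L (lam • (u - v)) = (lam * r) • L p := by rw [hr, smul_smul, map_smul]
  have hsgn := hgh _ ha (by rw [hLa]; exact smul_ne_zero hmu hp0)
  rw [hLa, dotProduct_smul, dotProduct_smul, smul_eq_mul, smul_eq_mul] at hsgn
  have hhp : h ⬝ᵥ L p ≤ 0 := by
    rw [hps, map_smul, map_sub, dotProduct_smul, dotProduct_sub, smul_eq_mul, hLx]
    exact mul_nonpos_of_nonneg_of_nonpos (inv_pos.2 (sub_pos.2 (hf s hs hsx))).le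
      (sub_nonpos.2 (hle s hs))
  have hsq : 0 < (lam * r) ^ 2 * ((h ⬝ᵥ L p) * (g ⬝ᵥ L p)) := by linarith
  have hprod : 0 < (h ⬝ᵥ L p) * (g ⬝ᵥ L p) := pos_of_mul_pos_right hsq (sq_nonneg _)
  have hgp : g ⬝ᵥ L p < 0 := by
    by_contra! hcon
    exact absurd hprod (not_lt.2 (mul_nonpos_of_nonpos_of_nonneg hhp hcon))
  exact ⟨hgp.le, fun e => absurd e hgp.ne⟩

/-- Correctness of the algorithm of Lemma 1.1 (EdgeDirections), bounded feasible case: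
the maximum of `c (W x)` over the feasible set `S` equals the maximum of `c (W (xv v))`
over the vertices `v` of the zonotope `Z` generated by the projected edge-directions. -/
theorem convex_max_via_zonotope_vertices {m n d : ℕ}
    (A : Matrix (Fin m) (Fin n) ℤ) (b : Fin m → ℤ)
    (w : Fin d → Fin n → ℤ)
    (S : Set (Fin n → ℝ)) (hS : S = feasSet A b)
    (hSne : S.Nonempty) (hSfin : S.Finite)
    (P : Set (Fin n → ℝ)) (hP : P = convexHull ℝ S)
    (W : (Fin n → ℝ) → (Fin d → ℝ))
    (hW : W = fun x => fun j => (intCast (w j)) ⬝ᵥ x)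
    (E : Finset (Fin n → ℤ))
    (hE : ∀ e : Set (Fin n → ℝ), IsEdge P e →
      ∃ g ∈ E, ∃ u ∈ e, ∃ v ∈ e, u ≠ v ∧ ∃ lam : ℝ, lam ≠ 0 ∧ intCast g = lam • (u - v))
    (D : Finset (Fin d → ℝ)) (hD : ∀ z, z ∈ D ↔ ∃ g ∈ E, z = W (intCast g))
    (Z : Set (Fin d → ℝ)) (hZ : Z = zone D)
    (gv : (Fin d → ℝ) → Fin d → ℝ) (xv : (Fin d → ℝ) → Fin n → ℝ)
    (hgv : ∀ v, IsVertex Z v → UniqueMax Z (gv v) v)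
    (hxvS : ∀ v, IsVertex Z v → xv v ∈ S)
    (hxvmax : ∀ v, IsVertex Z v → ∀ x ∈ S, gv v ⬝ᵥ W x ≤ gv v ⬝ᵥ W (xv v))
    (c : (Fin d → ℝ) → ℝ) (hc : ConvexOn ℝ Set.univ c) :
    ∃ M : ℝ, IsGreatest {t | ∃ x ∈ S, t = c (W x)} M ∧
      IsGreatest {t | ∃ v, IsVertex Z v ∧ t = c (W (xv v))} M := by
  classical
  obtain ⟨S, rfl⟩ := hSfin.exists_finset_coe
  subst hP hZ
  clear hS
  obtain ⟨L, hL⟩ : ∃ L : (Fin n → ℝ) →ₗ[ℝ] (Fin d → ℝ), ∀ x, W x = L x :=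
    ⟨Matrix.mulVecLin (Matrix.of fun j => intCast (w j)), fun x => by rw [hW]; rfl⟩
  simp only [hL] at hD hxvmax ⊢
  obtain ⟨U, hUS, hUhull, hUexp⟩ := exists_exposed_subset (S.image L)
  have hUne : U.Nonempty := by
    obtain ⟨x, hx⟩ := hSne
    have := hUhull (Finset.mem_image_of_mem L hx)
    exact (convexHull_nonempty_iff (𝕜 := ℝ)).1 ⟨_, this⟩
  obtain ⟨u, huU, humax⟩ := U.exists_max_image c hUne
  obtain ⟨x₀, hx₀, rfl⟩ := Finset.mem_image.1 (hUS huU)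
  have hmax : ∀ x ∈ S, c (L x) ≤ c (L x₀) := fun x hx => by
    obtain ⟨y, hy, hxy⟩ := hc.exists_ge_of_mem_convexHull (Set.subset_univ _)
      (hUhull (Finset.mem_image_of_mem L hx))
    exact hxy.trans (humax y hy)
  obtain ⟨l, hl⟩ := hUexp _ huU
  obtain ⟨h, hhD, hhU⟩ := exists_generic_functional D (S.image L) (L x₀) l hl
  have hvert := uniqueMax_zone_sum_sign D h hhD
  set ε : (Fin d → ℝ) → ℝ := fun δ => if 0 ≤ h ⬝ᵥ δ then 1 else -1 with hε
  set v := ∑ δ ∈ D, ε δ • δ with hv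
  have hvV : IsVertex (zone D) v := ⟨h, hvert⟩
  have hε1 : ∀ δ, ε δ = 1 ∨ ε δ = -1 := fun δ => by
    simp only [hε]
    split_ifs <;> simp
  have hxv : L (xv v) = L x₀ := by
    refine map_maximizer_eq S L {a | ∃ z ∈ E, a = intCast z} ?_ (gv v) h ?_ hx₀
      (fun s hs hne => hhU _ (Finset.mem_image_of_mem L hs) hne) (hxvS v hvV) (hxvmax v hvV)
    · intro e he
      obtain ⟨z, hz, hrest⟩ := hE e he
      exact ⟨_, ⟨z, hz, rfl⟩, hrest⟩
    · rintro _ ⟨z, hz, rfl⟩ hne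
      have hzD := (hD _).2 ⟨z, hz, rfl⟩
      have h1 := sign_of_uniqueMax_zone D h ε hε1 hvert hzD hne
      have h2 := sign_of_uniqueMax_zone D (gv v) ε hε1 (hgv v hvV) hzD hne
      rcases hε1 (L (intCast z)) with e | e <;> rw [e] at h1 h2 <;> nlinarith
  refine ⟨c (L x₀), ⟨⟨x₀, hx₀, rfl⟩, ?_⟩, ⟨v, hvV, by rw [hxv]⟩, ?_⟩
  · rintro _ ⟨x, hx, rfl⟩
    exact hmax x hx
  · rintro _ ⟨v', hv', rfl⟩
    exact hmax _ (hxvS v' hv')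
end
end

section
/- Let A ∈ ℤ^{m×n} and b ∈ ℤ^m, and let P = conv{x ∈ ℕ^n : Ax = b}. Then the Graver basis G(A) covers all edge-directions of P: for every edge e of P there exist an element g ∈ G(A), two distinct points u, v ∈ e ∩ ℤ^n, and a nonzero scalar λ with u − v = λ g. -/
open Matrix

noncomputable section

/-- The conformal order `u ⊑ v` on `ℤ^n`. -/
def ConformalTo {n : ℕ} (u v : Fin n → ℤ) : Prop :=
  ∀ i, 0 ≤ u i * v i ∧ |u i| ≤ |v i|

/-- The Graver basis of `A`: the `⊑`-minimal elements of `{x ∈ ℤ^n : Ax = 0} \ {0}`. -/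
def GraverBasis {m n : ℕ} (A : Matrix (Fin m) (Fin n) ℤ) : Set (Fin n → ℤ) :=
  {g | g ≠ 0 ∧ A.mulVec g = 0 ∧
    ∀ h : Fin n → ℤ, h ≠ 0 → A.mulVec h = 0 → ConformalTo h g → h = g}

/-- A face of a convex hull is contained in the convex hull of the generators lying on it. -/
lemma mem_convexHull_of_maximizes {k : ℕ} {S : Set (Fin k → ℝ)} {w x : Fin k → ℝ}
    (hx : x ∈ convexHull ℝ S) (hmax : ∀ y ∈ convexHull ℝ S, w ⬝ᵥ y ≤ w ⬝ᵥ x) :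
    x ∈ convexHull ℝ {y ∈ S | w ⬝ᵥ y = w ⬝ᵥ x} := by
  set H := convexHull ℝ {y ∈ S | w ⬝ᵥ y = w ⬝ᵥ x}
  have hconv : Convex ℝ {y | w ⬝ᵥ y < w ⬝ᵥ x ∨ (w ⬝ᵥ y = w ⬝ᵥ x ∧ y ∈ H)} := by
    rw [convex_iff_forall_pos]
    intro p hp q hq a b ha hb hab
    have hdot : w ⬝ᵥ (a • p + b • q) = a * (w ⬝ᵥ p) + b * (w ⬝ᵥ q) := by
      simp [dotProduct_add, dotProduct_smul]
    have hx' : w ⬝ᵥ x = a * (w ⬝ᵥ x) + b * (w ⬝ᵥ x) := by rw [← add_mul, hab, one_mul]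
    simp only [Set.mem_ofPred_eq] at hp hq ⊢
    rw [hdot]
    rcases hp with hp | ⟨hp, hpH⟩ <;> rcases hq with hq | ⟨hq, hqH⟩
    · left
      nlinarith
    · left
      rw [hq]
      nlinarith
    · left
      rw [hp]
      nlinarith
    · right
      exact ⟨by rw [hp, hq, ← hx'], convex_convexHull ℝ _ hpH hqH ha.le hb.le hab⟩
  have hsub : S ⊆ {y | w ⬝ᵥ y < w ⬝ᵥ x ∨ (w ⬝ᵥ y = w ⬝ᵥ x ∧ y ∈ H)} := fun y hy =>
    (hmax y (subset_convexHull ℝ S hy)).lt_or_eq.imp_right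
      fun h => ⟨h, subset_convexHull ℝ _ ⟨hy, h⟩⟩
  rcases convexHull_min hsub hconv hx with h | h
  · exact absurd h (lt_irrefl _)
  · exact h.2

/-- An edge of a convex hull contains two distinct generators. -/
lemma IsEdge.exists_ne_of_convexHull {k : ℕ} {S e : Set (Fin k → ℝ)}
    (he : IsEdge (convexHull ℝ S) e) : ∃ x ∈ S ∩ e, ∃ y ∈ S ∩ e, x ≠ y := by
  obtain ⟨⟨w, rfl⟩, hdim⟩ := he
  by_contra! hss
  have hsub : Set.Subsingleton {x | x ∈ convexHull ℝ S ∧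
      ∀ y ∈ convexHull ℝ S, w ⬝ᵥ y ≤ w ⬝ᵥ x} := by
    intro x hx y hy
    have hxy : w ⬝ᵥ y = w ⬝ᵥ x := le_antisymm (hx.2 y hy.1) (hy.2 x hx.1)
    have hgen : Set.Subsingleton {z ∈ S | w ⬝ᵥ z = w ⬝ᵥ x} := fun p hp q hq =>
      hss p ⟨hp.1, subset_convexHull ℝ S hp.1, hp.2 ▸ hx.2⟩
        q ⟨hq.1, subset_convexHull ℝ S hq.1, hq.2 ▸ hx.2⟩
    have hx' := mem_convexHull_of_maximizes hx.1 hx.2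
    have hy' := mem_convexHull_of_maximizes hy.1 hy.2
    rw [hxy] at hy'
    rw [hgen.convex.convexHull_eq] at hx' hy'
    exact hgen hx' hy'
  rw [(vectorSpan_eq_bot_iff_subsingleton _).2 hsub] at hdim
  simp at hdim

lemma ConformalTo.refl {n : ℕ} (z : Fin n → ℤ) : ConformalTo z z :=
  fun _ => ⟨mul_self_nonneg _, le_rfl⟩

lemma ConformalTo.trans {n : ℕ} {x y z : Fin n → ℤ} (hxy : ConformalTo x y)
    (hyz : ConformalTo y z) : ConformalTo x z := by
  intro i
  obtain ⟨h₁, h₂⟩ := hxy i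
  obtain ⟨h₃, h₄⟩ := hyz i
  refine ⟨?_, h₂.trans h₄⟩
  rcases eq_or_ne (y i) 0 with h | h
  · rw [h, abs_zero, abs_nonpos_iff] at h₂
    simp [h₂]
  · have h₅ : 0 < y i * y i := mul_self_pos.2 h
    nlinarith [mul_nonneg h₁ h₃]

/-- Every nonzero integer vector in the kernel of `A` has a conformal Graver basis element. -/
lemma exists_mem_graverBasis_conformalTo {m n : ℕ} {A : Matrix (Fin m) (Fin n) ℤ}
    {z : Fin n → ℤ} (hz : z ≠ 0) (hAz : A.mulVec z = 0) :
    ∃ g ∈ GraverBasis A, ConformalTo g z := by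
  let T : Set (Fin n → ℤ) := {g | g ≠ 0 ∧ A.mulVec g = 0 ∧ ConformalTo g z}
  have hT : T.Nonempty := ⟨z, hz, hAz, ConformalTo.refl z⟩
  let norm₁ : (Fin n → ℤ) → ℕ := fun g => ∑ i, (g i).natAbs
  let g := Function.argminOn norm₁ T hT
  obtain ⟨hg0, hAg, hgz⟩ : g ∈ T := Function.argminOn_mem norm₁ T hT
  refine ⟨g, ⟨hg0, hAg, fun h hh0 hAh hhg => ?_⟩, hgz⟩
  have hle : norm₁ g ≤ norm₁ h := Function.argminOn_le norm₁ T ⟨hh0, hAh, hhg.trans hgz⟩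
  have hcoord : ∀ i ∈ Finset.univ, (h i).natAbs ≤ (g i).natAbs := fun i _ => by
    have := (hhg i).2
    rwa [Int.abs_eq_natAbs, Int.abs_eq_natAbs, Nat.cast_le] at this
  have heq := (Finset.sum_eq_sum_iff_of_le hcoord).1 (le_antisymm (Finset.sum_le_sum hcoord) hle)
  funext i
  rcases Int.natAbs_eq_natAbs_iff.1 (heq i (Finset.mem_univ i)) with h' | h'
  · exact h'
  · have := (hhg i).1
    rw [h'] at this ⊢
    have : g i = 0 := mul_self_eq_zero.1 (by nlinarith [mul_self_nonneg (g i)])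
    simp [this]

lemma intCast_mem_feasSet {m n : ℕ} {A : Matrix (Fin m) (Fin n) ℤ} {b : Fin m → ℤ}
    {z : Fin n → ℤ} (hz : 0 ≤ z) (hAz : A.mulVec z = b) : intCast z ∈ feasSet A b := by
  have hcast : ∀ i, ((z i).toNat : ℤ) = z i := fun i => Int.toNat_of_nonneg (hz i)
  refine ⟨fun i => (z i).toNat, funext fun i => ?_, by simpa only [hcast] using hAz⟩
  change ((z i : ℤ) : ℝ) = _
  exact_mod_cast congrArg (Int.cast : ℤ → ℝ) (hcast i).symm

/-- Subtracting a vector conformal to `u - v` from `u` keeps it nonnegative. -/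
lemma ConformalTo.sub_nonneg {n : ℕ} {g u v : Fin n → ℤ} (hg : ConformalTo g (u - v))
    (hu : 0 ≤ u) (hv : 0 ≤ v) : 0 ≤ u - g := by
  intro i
  obtain ⟨h₁, h₂⟩ := hg i
  have hui := hu i
  have hvi := hv i
  simp only [Pi.zero_apply, Pi.sub_apply] at *
  rcases le_or_gt (u i - v i) 0 with h | h
  · rcases h.eq_or_lt with h' | h'
    · rw [h', abs_zero, abs_nonpos_iff] at h₂
      linarith
    · have := nonpos_of_mul_nonneg_left h₁ h'
      linarith
  · rw [abs_of_pos h] at h₂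
    linarith [le_abs_self (g i)]

lemma ConformalTo.neg {n : ℕ} {x y : Fin n → ℤ} (h : ConformalTo x y) :
    ConformalTo (-x) (-y) := fun i => by simpa using h i

/-- The Graver basis of `A` covers all edge-directions of `conv {x ∈ ℕ^n : Ax = b}`. -/
theorem graver_covers_edge_directions {m n : ℕ}
    (A : Matrix (Fin m) (Fin n) ℤ) (b : Fin m → ℤ)
    (P : Set (Fin n → ℝ)) (hP : P = convexHull ℝ (feasSet A b)) :
    ∀ e : Set (Fin n → ℝ), IsEdge P e →
      ∃ g ∈ GraverBasis A, ∃ u v : Fin n → ℤ,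
        intCast u ∈ e ∧ intCast v ∈ e ∧ u ≠ v ∧
        ∃ lam : ℝ, lam ≠ 0 ∧ intCast u - intCast v = lam • intCast g := by
  subst hP
  intro e he
  obtain ⟨_, ⟨⟨u, rfl, hAu⟩, hue⟩, _, ⟨⟨v, rfl, hAv⟩, hve⟩, huv⟩ := he.exists_ne_of_convexHull
  obtain ⟨⟨w, rfl⟩, -⟩ := he
  set u' : Fin n → ℤ := fun i => (u i : ℤ) with hu'
  set v' : Fin n → ℤ := fun i => (v i : ℤ) with hv'
  have hu0 : 0 ≤ u' := fun i => Int.natCast_nonneg _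
  have hv0 : 0 ≤ v' := fun i => Int.natCast_nonneg _
  have hcu : (fun i => (u i : ℝ)) = intCast u' := by funext i; simp [intCast, hu']
  have hcv : (fun i => (v i : ℝ)) = intCast v' := by funext i; simp [intCast, hv']
  rw [hcu] at hue huv
  rw [hcv] at hve huv
  have hne : u' - v' ≠ 0 := fun h => huv (by rw [sub_eq_zero.1 h])
  obtain ⟨g, hg, hgz⟩ := exists_mem_graverBasis_conformalTo (A := A) hne
    (by rw [mulVec_sub, hAu, hAv, sub_self])
  have hug : intCast (u' - g) ∈ convexHull ℝ (feasSet A b) := subset_convexHull ℝ _ <|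
    intCast_mem_feasSet (hgz.sub_nonneg hu0 hv0) (by rw [mulVec_sub, hAu, hg.2.1, sub_zero])
  have hvg : intCast (v' - -g) ∈ convexHull ℝ (feasSet A b) := subset_convexHull ℝ _ <|
    intCast_mem_feasSet
      (ConformalTo.sub_nonneg (by simpa using hgz.neg) hv0 hu0)
      (by rw [mulVec_sub, mulVec_neg, hAv, hg.2.1, neg_zero, sub_zero])
  have hcug : intCast (u' - g) = intCast u' - intCast g := by funext i; simp [intCast]
  have hcvg : intCast (v' - -g) = intCast v' + intCast g := by funext i; simp [intCast]
  have h₁ := hue.2 _ hug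
  have h₂ := hve.2 _ hvg
  rw [hcug, dotProduct_sub] at h₁
  rw [hcvg, dotProduct_add] at h₂
  refine ⟨g, hg, u', u' - g, hue, ⟨hug, fun y hy => ?_⟩, ?_, 1, one_ne_zero, ?_⟩
  · rw [hcug, dotProduct_sub]
    linarith [hue.2 y hy]
  · intro h
    exact hg.1 (sub_eq_self.1 h.symm)
  · rw [hcug, one_smul, sub_sub_cancel]
end
end

section
/- Let P ⊂ ℝ^n be a polytope (the convex hull of a finite set), let W : ℝ^n → ℝ^d be a linear map, and let Q = W(P). If a finite set E ⊂ ℝ^n covers all edge-directions of P, then the set D = {W e : e ∈ E} covers all edge-directions of Q: for every edge f of Q there exists e ∈ E such that W e is a nonzero scalar multiple of u − v for two distinct points u, v ∈ f. -/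
open Matrix

noncomputable section

section Face

variable {F : Type*} [AddCommGroup F] [Module ℝ F]

open scoped Classical in
/-- The points of the finite set `S` at which the linear functional `φ` is maximal on `S`. -/
def maxFace (S : Finset F) (φ : Module.Dual ℝ F) : Finset F :=
  S.filter fun x => ∀ y ∈ S, φ y ≤ φ x

theorem mem_maxFace {S : Finset F} {φ : Module.Dual ℝ F} {x : F} :
    x ∈ maxFace S φ ↔ x ∈ S ∧ ∀ y ∈ S, φ y ≤ φ x := by
  simp [maxFace]

theorem maxFace_subset (S : Finset F) (φ : Module.Dual ℝ F) : maxFace S φ ⊆ S :=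
  fun _ hx => (mem_maxFace.1 hx).1

/-- A face of a face of a finite set is a face. -/
theorem exists_maxFace_eq_maxFace_maxFace (S : Finset F) (φ ψ : Module.Dual ℝ F) :
    ∃ χ : Module.Dual ℝ F, maxFace S χ = maxFace (maxFace S φ) ψ := by
  have key : ∀ᶠ N : ℝ in Filter.atTop, ∀ s ∈ S, ∀ t ∈ S, φ t < φ s →
      ψ t - ψ s < N * (φ s - φ t) := by
    simp only [Finset.eventually_all]
    intro s _ t _
    by_cases h : φ t < φ s
    · filter_upwards [Filter.eventually_gt_atTop ((ψ t - ψ s) / (φ s - φ t))] with N hN _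
      exact (div_lt_iff₀ (sub_pos.2 h)).1 hN
    · exact Filter.Eventually.of_forall fun _ h' => absurd h' h
  obtain ⟨N, hN⟩ := key.exists
  refine ⟨N • φ + ψ, ?_⟩
  ext x
  simp only [mem_maxFace, LinearMap.add_apply, LinearMap.smul_apply, smul_eq_mul]
  constructor
  · rintro ⟨hx, hmax⟩
    have hφ : ∀ y ∈ S, φ y ≤ φ x := by
      intro y hy
      by_contra! hlt
      have h₁ := hN y hy x hx hlt
      have h₂ := hmax y hy
      linarith
    refine ⟨⟨hx, hφ⟩, fun y hy => ?_⟩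
    have h₁ := hmax y hy.1
    rw [le_antisymm (hφ y hy.1) (hy.2 x hx)] at h₁
    linarith
  · rintro ⟨⟨hx, hφ⟩, hψ⟩
    refine ⟨hx, fun y hy => ?_⟩
    rcases (hφ y hy).lt_or_eq with hlt | heq
    · have h₁ := hN x hx y hy hlt
      linarith
    · have h₁ := hψ y ⟨hy, fun z hz => heq ▸ hφ z hz⟩
      rw [heq]
      linarith

/-- The face of a polytope on which a functional is maximal is spanned by the generators
on which it is maximal. -/
theorem setOf_isMax_convexHull (S : Finset F) (φ : Module.Dual ℝ F) :
    {x | x ∈ convexHull ℝ (S : Set F) ∧ ∀ y ∈ convexHull ℝ (S : Set F), φ y ≤ φ x} =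
      convexHull ℝ (maxFace S φ : Set F) := by
  classical
  rcases S.eq_empty_or_nonempty with rfl | hne
  · simp [maxFace]
  obtain ⟨m, hm, hmax⟩ := S.exists_max_image φ hne
  have hmF : m ∈ maxFace S φ := mem_maxFace.2 ⟨hm, hmax⟩
  have hle : ∀ y ∈ convexHull ℝ (S : Set F), φ y ≤ φ m :=
    convexHull_min (fun y hy => hmax y hy) (convex_halfSpace_le φ.isLinear _)
  have heq : ∀ y ∈ convexHull ℝ (maxFace S φ : Set F), φ y = φ m :=
    convexHull_min
      (fun y hy => le_antisymm (hmax y (mem_maxFace.1 hy).1) ((mem_maxFace.1 hy).2 m hm))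
      (convex_hyperplane φ.isLinear _)
  ext x
  constructor
  · rintro ⟨hx, hxmax⟩
    have hxm : φ m ≤ φ x := hxmax m (subset_convexHull ℝ _ hm)
    have hlt : ∀ y ∈ convexHull ℝ ((S \ maxFace S φ : Finset F) : Set F), φ y < φ m := by
      refine convexHull_min (fun y hy => ?_) (convex_halfSpace_lt φ.isLinear _)
      rw [Finset.mem_coe, Finset.mem_sdiff] at hy
      refine lt_of_le_of_ne (hmax y hy.1) fun h => hy.2 (mem_maxFace.2 ⟨hy.1, ?_⟩)
      rw [h]
      exact hmax
    have hS : (S : Set F) = (maxFace S φ : Set F) ∪ ((S \ maxFace S φ : Finset F) : Set F) := by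
      rw [← Finset.coe_union, Finset.union_sdiff_of_subset (maxFace_subset S φ)]
    rcases (S \ maxFace S φ).eq_empty_or_nonempty with h0 | h0
    · rwa [hS, h0, Finset.coe_empty, Set.union_empty] at hx
    rw [hS, convexHull_union ⟨m, hmF⟩ h0, mem_convexJoin] at hx
    obtain ⟨a, ha, b, hb, s, t, hs, ht, hst, rfl⟩ := hx
    have h₁ := hlt b hb
    have h₂ := heq a ha
    simp only [map_add, map_smul, smul_eq_mul, h₂] at hxm
    obtain rfl : t = 0 := by
      by_contra h
      have : 0 < t := lt_of_le_of_ne ht (Ne.symm h)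
      have hs' : s = 1 - t := by linarith
      subst hs'
      nlinarith
    obtain rfl : s = 1 := by linarith
    simpa using ha
  · intro hx
    refine ⟨convexHull_mono (maxFace_subset S φ) hx, fun y hy => ?_⟩
    rw [heq x hx]
    exact hle y hy

theorem vectorSpan_convexHull (s : Set F) :
    vectorSpan ℝ (convexHull ℝ s) = vectorSpan ℝ s := by
  rw [← direction_affineSpan, affineSpan_convexHull, direction_affineSpan]

/-- If `l` is not constant on `S` and `m` is any functional, then some combination `m - t • l`
is maximal on a face of `S` on which `l` is not constant. -/
theorem exists_maxFace_sub_smul_nonconstant (S : Finset F) (l m : Module.Dual ℝ F)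
    (hl : ∃ a ∈ S, ∃ b ∈ S, l a ≠ l b) :
    ∃ t : ℝ, ∃ a ∈ maxFace S (m - t • l), ∃ b ∈ maxFace S (m - t • l), l a ≠ l b := by
  classical
  obtain ⟨p, hp, q, hq, hpq⟩ := hl
  obtain ⟨a₀, ha₀, hmin⟩ := S.exists_min_image l ⟨p, hp⟩
  obtain ⟨a, ha, hamax⟩ := (S.filter fun x => l x = l a₀).exists_max_image m
    ⟨a₀, by simp [ha₀]⟩
  simp only [Finset.mem_filter] at ha hamax
  have hmin' : ∀ x ∈ S, l a ≤ l x := fun x hx => ha.2 ▸ hmin x hx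
  have hne : (S.filter fun x => l a < l x).Nonempty := by
    rcases lt_or_gt_of_ne hpq with h | h
    · exact ⟨q, Finset.mem_filter.2 ⟨hq, (hmin' p hp).trans_lt h⟩⟩
    · exact ⟨p, Finset.mem_filter.2 ⟨hp, (hmin' q hq).trans_lt h⟩⟩
  obtain ⟨b, hb, hbmax⟩ :=
    (S.filter fun x => l a < l x).exists_max_image (fun x => (m x - m a) / (l x - l a)) hne
  simp only [Finset.mem_filter] at hb hbmax
  set t := (m b - m a) / (l b - l a) with ht
  have htb : m b - m a = t * (l b - l a) := by
    rw [ht, div_mul_cancel₀ _ (sub_pos.2 hb.2).ne']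
  have hle : ∀ x ∈ S, m x - t * l x ≤ m a - t * l a := by
    intro x hx
    rcases (hmin' x hx).lt_or_eq with hlt | heq
    · have h := (div_le_iff₀ (sub_pos.2 hlt)).1 (hbmax x ⟨hx, hlt⟩)
      linarith
    · have h := hamax x ⟨hx, heq ▸ ha.2⟩
      rw [← heq]
      linarith
  refine ⟨t, a, mem_maxFace.2 ⟨ha.1, fun x hx => ?_⟩, b,
    mem_maxFace.2 ⟨hb.1, fun x hx => ?_⟩, hb.2.ne⟩
  · simpa using hle x hx
  · have h := hle x hx
    simp only [LinearMap.sub_apply, LinearMap.smul_apply, smul_eq_mul]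
    linarith

/-- If `l` is not constant on a finite set, then it is not constant on some edge of its
convex hull. -/
theorem exists_maxFace_finrank_one_nonconstant (S : Finset F) (l : Module.Dual ℝ F)
    (hl : ∃ a ∈ S, ∃ b ∈ S, l a ≠ l b) :
    ∃ φ : Module.Dual ℝ F, Module.finrank ℝ (vectorSpan ℝ (maxFace S φ : Set F)) = 1 ∧
      ∃ a ∈ maxFace S φ, ∃ b ∈ maxFace S φ, l a ≠ l b := by
  induction S using Finset.strongInduction with
  | H S ih =>
    by_cases hker : ∃ x ∈ vectorSpan ℝ (S : Set F), l x = 0 ∧ x ≠ 0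
    · obtain ⟨x, hx, hlx, hx0⟩ := hker
      obtain ⟨m, hm⟩ : ∃ m : Module.Dual ℝ F, m x ≠ 0 := by
        by_contra! h
        exact hx0 ((Module.forall_dual_apply_eq_zero_iff ℝ x).1 h)
      obtain ⟨t, hab⟩ := exists_maxFace_sub_smul_nonconstant S l m hl
      have hss : maxFace S (m - t • l) ⊂ S := by
        refine (maxFace_subset S _).ssubset_of_ne fun h => hm ?_
        have hspan : vectorSpan ℝ (S : Set F) ≤ LinearMap.ker (m - t • l) := by
          rw [vectorSpan_def, Submodule.span_le]
          rintro _ ⟨y, hy, z, hz, rfl⟩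
          rw [Finset.mem_coe] at hy hz
          have h₁ := (mem_maxFace.1 (h.symm ▸ hy)).2 z hz
          have h₂ := (mem_maxFace.1 (h.symm ▸ hz)).2 y hy
          simp only [SetLike.mem_coe, LinearMap.mem_ker, vsub_eq_sub, map_sub]
          linarith
        simpa [hlx] using hspan hx
      obtain ⟨ψ, h1, hψ⟩ := ih _ hss hab
      obtain ⟨χ, hχ⟩ := exists_maxFace_eq_maxFace_maxFace S (m - t • l) ψ
      exact ⟨χ, hχ ▸ h1, hχ ▸ hψ⟩
    · push Not at hker
      have hS : maxFace S (0 : Module.Dual ℝ F) = S := by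
        ext x
        simp [mem_maxFace]
      refine ⟨0, ?_, by rwa [hS]⟩
      rw [hS]
      obtain ⟨a, ha, b, hb, hab⟩ := hl
      have hmem : a - b ∈ vectorSpan ℝ (S : Set F) := vsub_mem_vectorSpan ℝ ha hb
      have hlab : l (a - b) ≠ 0 := by rwa [map_sub, sub_ne_zero]
      refine finrank_eq_one (⟨a - b, hmem⟩ : vectorSpan ℝ (S : Set F))
        (fun h => hlab (by rw [show a - b = 0 from congrArg Subtype.val h, map_zero]))
        fun w => ⟨l w / l (a - b), ?_⟩
      have h0 := hker ((l w / l (a - b)) • (a - b) - w)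
        (sub_mem (Submodule.smul_mem _ _ hmem) w.2)
        (by rw [map_sub, map_smul, smul_eq_mul, div_mul_cancel₀ _ hlab, sub_self])
      exact Subtype.ext (sub_eq_zero.1 h0)

end Face

/-- If `E` covers all edge-directions of a polytope `P`, then the image of `E` under a
linear map `W` covers all edge-directions of the projected polytope `Q = W(P)`. -/
theorem projected_edge_directions {n d : ℕ}
    (V : Finset (Fin n → ℝ)) (P : Set (Fin n → ℝ)) (hP : P = convexHull ℝ (V : Set (Fin n → ℝ)))
    (W : (Fin n → ℝ) →ₗ[ℝ] (Fin d → ℝ))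
    (Q : Set (Fin d → ℝ)) (hQ : Q = W '' P)
    (E : Finset (Fin n → ℝ))
    (hE : ∀ e : Set (Fin n → ℝ), IsEdge P e →
      ∃ g ∈ E, ∃ u ∈ e, ∃ v ∈ e, u ≠ v ∧ ∃ lam : ℝ, lam ≠ 0 ∧ g = lam • (u - v)) :
    ∀ f : Set (Fin d → ℝ), IsEdge Q f →
      ∃ g ∈ E, ∃ u ∈ f, ∃ v ∈ f, u ≠ v ∧ ∃ lam : ℝ, lam ≠ 0 ∧ W g = lam • (u - v) := by
  rintro f ⟨⟨w, hf⟩, hf1⟩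
  subst hP hQ
  set c : Module.Dual ℝ (Fin n → ℝ) := dotProductBilin ℝ ℝ w ∘ₗ W
  have hfW : f = W '' convexHull ℝ (maxFace V c : Set (Fin n → ℝ)) := by
    rw [hf, ← setOf_isMax_convexHull]
    ext x
    constructor
    · rintro ⟨⟨p, hp, rfl⟩, hmax⟩
      exact ⟨p, ⟨hp, fun y hy => hmax _ ⟨y, hy, rfl⟩⟩, rfl⟩
    · rintro ⟨p, ⟨hp, hmax⟩, rfl⟩
      exact ⟨⟨p, hp, rfl⟩, by rintro _ ⟨y, hy, rfl⟩; exact hmax y hy⟩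
  obtain ⟨u, hu, v, hv, huv⟩ : f.Nontrivial := by
    by_contra h
    rw [Set.not_nontrivial_iff] at h
    rw [vectorSpan_of_subsingleton ℝ h, finrank_bot] at hf1
    exact zero_ne_one hf1
  rw [hfW] at hu hv
  obtain ⟨p, hp, rfl⟩ := hu
  obtain ⟨q, hq, rfl⟩ := hv
  obtain ⟨k, hk⟩ : ∃ k : Module.Dual ℝ (Fin d → ℝ), k (W p - W q) ≠ 0 := by
    by_contra! h
    exact huv (sub_eq_zero.1 ((Module.forall_dual_apply_eq_zero_iff ℝ _).1 h))
  have hl : ∃ a ∈ maxFace V c, ∃ b ∈ maxFace V c, (k ∘ₗ W) a ≠ (k ∘ₗ W) b := by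
    by_contra! h
    obtain ⟨s, hs⟩ := convexHull_nonempty_iff.1 ⟨p, hp⟩
    have hconst : ∀ x ∈ convexHull ℝ (maxFace V c : Set (Fin n → ℝ)),
        (k ∘ₗ W) x = (k ∘ₗ W) s :=
      convexHull_min (fun x hx => h x hx s hs) (convex_hyperplane (k ∘ₗ W).isLinear _)
    apply hk
    rw [map_sub, sub_eq_zero]
    exact (hconst p hp).trans (hconst q hq).symm
  obtain ⟨ψ, h1, a, ha, b, hb, hab⟩ := exists_maxFace_finrank_one_nonconstant _ _ hl
  obtain ⟨χ, hχ⟩ := exists_maxFace_eq_maxFace_maxFace V c ψ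
  set T := maxFace (maxFace V c) ψ
  have hTV : convexHull ℝ (T : Set (Fin n → ℝ)) ⊆ convexHull ℝ (maxFace V c : Set _) :=
    convexHull_mono (maxFace_subset _ _)
  have hT1 : Module.finrank ℝ (vectorSpan ℝ (convexHull ℝ (T : Set (Fin n → ℝ)))) = 1 := by
    rwa [vectorSpan_convexHull]
  have hedge : IsEdge (convexHull ℝ (V : Set (Fin n → ℝ))) (convexHull ℝ (T : Set _)) := by
    refine ⟨⟨(dotProductEquiv ℝ (Fin n)).symm χ, ?_⟩, hT1⟩
    have hdot : ∀ x, (dotProductEquiv ℝ (Fin n)).symm χ ⬝ᵥ x = χ x := fun x =>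
      LinearMap.congr_fun ((dotProductEquiv ℝ (Fin n)).apply_symm_apply χ) x
    simp only [hdot]
    rw [setOf_isMax_convexHull, hχ]
  obtain ⟨g, hg, u, hu, v, hv, huv, lam, hlam, rfl⟩ := hE _ hedge
  refine ⟨_, hg, W u, hfW ▸ ⟨u, hTV hu, rfl⟩, W v, hfW ▸ ⟨v, hTV hv, rfl⟩, fun h => hab ?_,
    lam, hlam, by rw [map_smul, map_sub]⟩
  obtain ⟨r, hr⟩ := exists_smul_eq_of_finrank_eq_one hT1
    (x := ⟨u - v, vsub_mem_vectorSpan ℝ hu hv⟩)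
    (fun h0 => huv (sub_eq_zero.1 (congrArg Subtype.val h0)))
    ⟨a - b, vsub_mem_vectorSpan ℝ (subset_convexHull ℝ _ ha) (subset_convexHull ℝ _ hb)⟩
  have hr' : r • (u - v) = a - b := congrArg Subtype.val hr
  rw [← sub_eq_zero, ← map_sub, ← hr', map_smul, LinearMap.comp_apply, map_sub, h, sub_self,
    map_zero, smul_zero]
end
end

section
/- Let P ⊂ ℝ^n be a polytope (the convex hull of a finite set), let E ⊂ ℝ^n be a finite set covering all edge-directions of P, and let Z = zone(E) be the zonotope generated by E. Then Z is a refinement of P in the following sense: for every w ∈ ℝ^n, if w attains its maximum over Z at a unique point, then w attains its maximum over P at a unique point. -/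
open Matrix

noncomputable section

/-- The points of a finite set at which the functional `w` is maximal. -/
def argmaxOn {n : ℕ} (V : Finset (Fin n → ℝ)) (w : Fin n → ℝ) : Finset (Fin n → ℝ) :=
  open scoped Classical in V.filter fun x => ∀ y ∈ V, w ⬝ᵥ y ≤ w ⬝ᵥ x

lemma mem_argmaxOn {n : ℕ} {V : Finset (Fin n → ℝ)} {w x : Fin n → ℝ} :
    x ∈ argmaxOn V w ↔ x ∈ V ∧ ∀ y ∈ V, w ⬝ᵥ y ≤ w ⬝ᵥ x := by
  simp [argmaxOn]

lemma argmaxOn_nonempty {n : ℕ} {V : Finset (Fin n → ℝ)} (hV : V.Nonempty) (w : Fin n → ℝ) :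
    (argmaxOn V w).Nonempty := by
  obtain ⟨x, hx, h⟩ := V.exists_max_image (fun x => w ⬝ᵥ x) hV
  exact ⟨x, mem_argmaxOn.2 ⟨hx, h⟩⟩

lemma dotProduct_le_of_mem_convexHull {n : ℕ} {s : Set (Fin n → ℝ)} {w : Fin n → ℝ} {c : ℝ}
    (h : ∀ y ∈ s, w ⬝ᵥ y ≤ c) {x : Fin n → ℝ} (hx : x ∈ convexHull ℝ s) : w ⬝ᵥ x ≤ c := by
  have hconv : Convex ℝ {x : Fin n → ℝ | w ⬝ᵥ x ≤ c} :=
    convex_halfSpace_le ⟨dotProduct_add w, fun r x => dotProduct_smul r w x⟩ c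
  exact convexHull_min h hconv hx

lemma dotProduct_eq_of_mem_convexHull {n : ℕ} {s : Set (Fin n → ℝ)} {w : Fin n → ℝ} {c : ℝ}
    (h : ∀ y ∈ s, w ⬝ᵥ y = c) {x : Fin n → ℝ} (hx : x ∈ convexHull ℝ s) : w ⬝ᵥ x = c := by
  have hconv : Convex ℝ {x : Fin n → ℝ | w ⬝ᵥ x = c} :=
    convex_hyperplane ⟨dotProduct_add w, fun r x => dotProduct_smul r w x⟩ c
  exact convexHull_min h hconv hx

/-- A face of a polytope is the convex hull of the generators it contains. -/
lemma mem_convexHull_argmaxOn {n : ℕ} {V : Finset (Fin n → ℝ)} {w x : Fin n → ℝ}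
    (hx : x ∈ convexHull ℝ (V : Set (Fin n → ℝ))) (hmax : ∀ y ∈ V, w ⬝ᵥ y ≤ w ⬝ᵥ x) :
    x ∈ convexHull ℝ (argmaxOn V w : Set (Fin n → ℝ)) := by
  obtain ⟨c, hc0, hc1, hcx⟩ := Finset.mem_convexHull'.1 hx
  have hwx : ∑ y ∈ V, c y * (w ⬝ᵥ y) = w ⬝ᵥ x := by
    rw [← hcx, dotProduct_sum]
    simp
  have hsum : ∑ y ∈ V, c y * (w ⬝ᵥ x - w ⬝ᵥ y) = 0 := by
    simp only [mul_sub, Finset.sum_sub_distrib, ← Finset.sum_mul, hc1, hwx]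
    ring
  have hzero := (Finset.sum_eq_zero_iff_of_nonneg
    (fun y hy => mul_nonneg (hc0 y hy) (sub_nonneg.2 (hmax y hy)))).1 hsum
  have hsub : argmaxOn V w ⊆ V := fun y hy => (mem_argmaxOn.1 hy).1
  have hc : ∀ y ∈ V, y ∉ argmaxOn V w → c y = 0 := by
    intro y hy hny
    by_contra hne
    have := (mul_eq_zero.1 (hzero y hy)).resolve_left hne
    exact hny (mem_argmaxOn.2 ⟨hy, fun z hz => (hmax z hz).trans (sub_eq_zero.1 this).le⟩)
  refine Finset.mem_convexHull'.2 ⟨c, fun y hy => hc0 y (hsub hy), ?_, ?_⟩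
  · rw [Finset.sum_subset hsub hc, hc1]
  · rw [Finset.sum_subset hsub fun y hy hny => by rw [hc y hy hny, zero_smul], hcx]

/-- A face of a face is a face. -/
lemma exists_argmaxOn_eq_argmaxOn_argmaxOn {n : ℕ} {V : Finset (Fin n → ℝ)} (hV : V.Nonempty)
    (w u : Fin n → ℝ) : ∃ w', argmaxOn V w' = argmaxOn (argmaxOn V w) u := by
  have hsmall : ∀ᶠ δ : ℝ in nhdsWithin 0 (Set.Ioi 0), ∀ x ∈ argmaxOn V w, ∀ y ∈ V,
      w ⬝ᵥ y < w ⬝ᵥ x → w ⬝ᵥ y + δ * (u ⬝ᵥ y) < w ⬝ᵥ x + δ * (u ⬝ᵥ x) := by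
    refine Filter.Eventually.filter_mono nhdsWithin_le_nhds ?_
    refine (Filter.eventually_all_finset _).2 fun x _ => (Filter.eventually_all_finset _).2
      fun y _ => ?_
    by_cases h : w ⬝ᵥ y < w ⬝ᵥ x
    · have h1 : ContinuousAt (fun δ : ℝ => w ⬝ᵥ y + δ * (u ⬝ᵥ y)) 0 := by fun_prop
      have h2 : ContinuousAt (fun δ : ℝ => w ⬝ᵥ x + δ * (u ⬝ᵥ x)) 0 := by fun_prop
      filter_upwards [h1.eventually_lt h2 (by simpa using h)] with δ hδ _ using hδ
    · exact Filter.Eventually.of_forall fun δ h' => absurd h' h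
  obtain ⟨δ, hδ, hpos⟩ := (hsmall.and self_mem_nhdsWithin).exists
  refine ⟨w + δ • u, ?_⟩
  obtain ⟨a, ha⟩ := argmaxOn_nonempty hV w
  have haV := mem_argmaxOn.1 ha
  ext x
  simp only [mem_argmaxOn (x := x), add_dotProduct, smul_dotProduct, smul_eq_mul]
  constructor
  · rintro ⟨hx, hmax⟩
    have hax : w ⬝ᵥ a ≤ w ⬝ᵥ x := by
      by_contra! hlt
      exact absurd (hδ a ha x hx hlt) (hmax a haV.1).not_gt
    refine ⟨⟨hx, fun y hy => (haV.2 y hy).trans hax⟩, fun y hy => ?_⟩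
    have hy' := mem_argmaxOn.1 hy
    have h1 := hmax y hy'.1
    have h2 := hy'.2 x hx
    exact le_of_mul_le_mul_left (by linarith) hpos
  · rintro ⟨⟨hx, hmax⟩, hu⟩
    refine ⟨hx, fun y hy => ?_⟩
    rcases (hmax y hy).lt_or_eq with hlt | heq
    · exact (hδ x (mem_argmaxOn.2 ⟨hx, hmax⟩) y hy hlt).le
    · have hyW : y ∈ argmaxOn V w := mem_argmaxOn.2 ⟨hy, fun z hz => heq ▸ hmax z hz⟩
      have := mul_le_mul_of_nonneg_left (hu y hyW) hpos.le
      linarith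

/-- If `a` maximizes `f` but not `g`, then some `f + t • g` has `a` among several maximizers. -/
lemma exists_nontrivial_argmaxOn_add_smul {n : ℕ} {W : Finset (Fin n → ℝ)} {f g a b : Fin n → ℝ}
    (ha : a ∈ argmaxOn W f) (hb : b ∈ W) (hg : g ⬝ᵥ a < g ⬝ᵥ b) :
    ∃ t : ℝ, (argmaxOn W (f + t • g)).Nontrivial := by
  classical
  obtain ⟨haW, hmax⟩ := mem_argmaxOn.1 ha
  obtain ⟨c, hc, hmin⟩ := (W.filter fun y => g ⬝ᵥ a < g ⬝ᵥ y).exists_min_image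
    (fun y => (f ⬝ᵥ a - f ⬝ᵥ y) / (g ⬝ᵥ y - g ⬝ᵥ a)) ⟨b, Finset.mem_filter.2 ⟨hb, hg⟩⟩
  obtain ⟨hcW, hgc⟩ := Finset.mem_filter.1 hc
  set t := (f ⬝ᵥ a - f ⬝ᵥ c) / (g ⬝ᵥ c - g ⬝ᵥ a) with ht
  have ht0 : 0 ≤ t := div_nonneg (sub_nonneg.2 (hmax c hcW)) (sub_pos.2 hgc).le
  have htc : t * (g ⬝ᵥ c - g ⬝ᵥ a) = f ⬝ᵥ a - f ⬝ᵥ c :=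
    div_mul_cancel₀ _ (sub_pos.2 hgc).ne'
  have key : ∀ y ∈ W, f ⬝ᵥ y + t * (g ⬝ᵥ y) ≤ f ⬝ᵥ a + t * (g ⬝ᵥ a) := by
    intro y hy
    rcases lt_or_ge (g ⬝ᵥ a) (g ⬝ᵥ y) with h | h
    · have := (le_div_iff₀ (sub_pos.2 h)).1 (hmin y (Finset.mem_filter.2 ⟨hy, h⟩))
      linarith
    · have := mul_le_mul_of_nonneg_left h ht0
      linarith [hmax y hy]
  refine ⟨t, a, ?_, c, ?_, ?_⟩
  · simp only [Finset.mem_coe, mem_argmaxOn, add_dotProduct, smul_dotProduct, smul_eq_mul]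
    exact ⟨haW, key⟩
  · simp only [Finset.mem_coe, mem_argmaxOn, add_dotProduct, smul_dotProduct, smul_eq_mul]
    exact ⟨hcW, fun y hy => (key y hy).trans (by linarith)⟩
  · rintro rfl
    exact hgc.false

/-- A finite set with no proper face having more than one point is collinear. -/
lemma collinear_of_forall_argmaxOn {n : ℕ} {W : Finset (Fin n → ℝ)}
    (h : ∀ u : Fin n → ℝ, (argmaxOn W u).Nontrivial → argmaxOn W u = W) :
    Collinear ℝ (W : Set (Fin n → ℝ)) := by
  by_cases hW : W.Nontrivial
  swap
  · rcases (Set.not_nontrivial_iff.1 hW).eq_empty_or_singleton with h0 | ⟨x, hx⟩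
    · exact h0 ▸ collinear_empty ℝ _
    · exact hx ▸ collinear_singleton ℝ x
  obtain ⟨p, hp, q, hq, hpq⟩ := hW
  obtain ⟨i, hi⟩ := Function.ne_iff.1 hpq
  set f : Fin n → ℝ := Pi.single i 1
  have hf : f ⬝ᵥ p ≠ f ⬝ᵥ q := by simpa [f] using hi
  have hconst : ∀ u : Fin n → ℝ, (argmaxOn W u).Nontrivial → ∀ x ∈ W, ∀ y ∈ W,
      u ⬝ᵥ x = u ⬝ᵥ y := by
    intro u hu x hx y hy
    rw [← h u hu] at hx hy
    exact le_antisymm ((mem_argmaxOn.1 hy).2 x (mem_argmaxOn.1 hx).1)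
      ((mem_argmaxOn.1 hx).2 y (mem_argmaxOn.1 hy).1)
  obtain ⟨a, ha⟩ := argmaxOn_nonempty ⟨p, hp⟩ f
  have haW := (mem_argmaxOn.1 ha).1
  have hlin : ∀ g : Fin n → ℝ, ∃ s : ℝ, ∀ x ∈ W, g ⬝ᵥ x - g ⬝ᵥ a = s * (f ⬝ᵥ x - f ⬝ᵥ a) := by
    intro g
    have aux : ∀ g : Fin n → ℝ, ∀ b ∈ W, g ⬝ᵥ a < g ⬝ᵥ b →
        ∃ s : ℝ, ∀ x ∈ W, g ⬝ᵥ x - g ⬝ᵥ a = s * (f ⬝ᵥ x - f ⬝ᵥ a) := by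
      intro g b hb hg
      obtain ⟨t, ht⟩ := exists_nontrivial_argmaxOn_add_smul ha hb hg
      have hc := hconst _ ht
      simp only [add_dotProduct, smul_dotProduct, smul_eq_mul] at hc
      have ht0 : t ≠ 0 := by
        rintro rfl
        exact hf (by simpa using hc p hp q hq)
      refine ⟨-t⁻¹, fun x hx => ?_⟩
      have := hc x hx a haW
      field_simp
      linarith
    by_cases hg : ∃ b ∈ W, g ⬝ᵥ b ≠ g ⬝ᵥ a
    · obtain ⟨b, hb, hne⟩ := hg
      rcases hne.lt_or_gt with hlt | hgt
      · obtain ⟨s, hs⟩ := aux (-g) b hb (by simpa using hlt)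
        refine ⟨-s, fun x hx => ?_⟩
        have := hs x hx
        simp only [neg_dotProduct] at this
        linarith
      · exact aux g b hb hgt
    · push Not at hg
      exact ⟨0, fun x hx => by rw [hg x hx]; ring⟩
  choose s hs using fun j : Fin n => hlin (Pi.single j 1)
  refine (collinear_iff_of_mem haW).2 ⟨s, fun x hx => ⟨f ⬝ᵥ x - f ⬝ᵥ a, ?_⟩⟩
  ext j
  have := hs j x hx
  simp only [single_one_dotProduct] at this
  simp only [vadd_eq_add, Pi.add_apply, Pi.smul_apply, smul_eq_mul]
  linarith

/-- A face of a polytope with more than one generator contains an edge. -/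
lemma exists_isEdge_of_nontrivial {n : ℕ} {V : Finset (Fin n → ℝ)} {w : Fin n → ℝ}
    (hw : (argmaxOn V w).Nontrivial) :
    ∃ e, IsEdge (convexHull ℝ (V : Set (Fin n → ℝ))) e ∧
      e ⊆ convexHull ℝ (argmaxOn V w : Set (Fin n → ℝ)) := by
  classical
  have hV : V.Nonempty := by
    obtain ⟨p, hp, -⟩ := hw
    exact ⟨p, (mem_argmaxOn.1 hp).1⟩
  obtain ⟨W, hW, hmin⟩ := (V.powerset.filter fun W =>
      W.Nontrivial ∧ W ⊆ argmaxOn V w ∧ ∃ w', W = argmaxOn V w').exists_min_image Finset.card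
    ⟨argmaxOn V w, Finset.mem_filter.2 ⟨Finset.mem_powerset.2 fun x hx => (mem_argmaxOn.1 hx).1,
      hw, subset_rfl, w, rfl⟩⟩
  obtain ⟨hWV, hWnt, hWw, w', hWw'⟩ := Finset.mem_filter.1 hW
  rw [Finset.mem_powerset] at hWV
  have hcol : Collinear ℝ (W : Set (Fin n → ℝ)) := by
    refine collinear_of_forall_argmaxOn fun u hu => ?_
    have hsub : argmaxOn W u ⊆ W := fun x hx => (mem_argmaxOn.1 hx).1
    obtain ⟨w'', hw''⟩ := exists_argmaxOn_eq_argmaxOn_argmaxOn hV w' u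
    rw [← hWw'] at hw''
    exact Finset.eq_of_subset_of_card_le hsub (hmin _ (Finset.mem_filter.2
      ⟨Finset.mem_powerset.2 (hsub.trans hWV), hu, hsub.trans hWw, w'', hw''.symm⟩))
  set e := {x | x ∈ convexHull ℝ (V : Set (Fin n → ℝ)) ∧
    ∀ y ∈ convexHull ℝ (V : Set (Fin n → ℝ)), w' ⬝ᵥ y ≤ w' ⬝ᵥ x} with he
  have heW : e ⊆ convexHull ℝ (W : Set (Fin n → ℝ)) := by
    rintro x ⟨hx, hmax⟩
    rw [hWw']
    exact mem_convexHull_argmaxOn hx fun y hy => hmax y (subset_convexHull ℝ _ hy)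
  have hWe : (W : Set (Fin n → ℝ)) ⊆ e := by
    intro x hx
    rw [hWw', Finset.mem_coe, mem_argmaxOn] at hx
    exact ⟨subset_convexHull ℝ _ hx.1, fun y hy => dotProduct_le_of_mem_convexHull hx.2 hy⟩
  refine ⟨e, ⟨⟨w', rfl⟩, ?_⟩, heW.trans (convexHull_mono (Finset.coe_subset.2 hWw))⟩
  have hspan : vectorSpan ℝ e = vectorSpan ℝ (W : Set (Fin n → ℝ)) := by
    refine le_antisymm ?_ (vectorSpan_mono ℝ hWe)
    rw [← direction_affineSpan ℝ (W : Set (Fin n → ℝ)), ← affineSpan_convexHull,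
      direction_affineSpan]
    exact vectorSpan_mono ℝ heW
  rw [hspan]
  refine le_antisymm (collinear_iff_finrank_le_one.1 hcol) ?_
  rw [Submodule.one_le_finrank_iff, Ne, vectorSpan_eq_bot_iff_subsingleton]
  exact Set.not_subsingleton_iff.2 hWnt

/-- A functional with a unique maximizer over a zonotope vanishes on no nonzero generator. -/
lemma dotProduct_ne_zero_of_uniqueMax_zone {n : ℕ} {E : Finset (Fin n → ℝ)} {w z : Fin n → ℝ}
    (hz : UniqueMax (zone E) w z) {g : Fin n → ℝ} (hg : g ∈ E) (hg0 : g ≠ 0) : w ⬝ᵥ g ≠ 0 := by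
  classical
  intro hwg
  have hmem : ∀ ε : (Fin n → ℝ) → ℝ, (∀ e, ε e = 1 ∨ ε e = -1) → ∑ e ∈ E, ε e • e ∈ zone E :=
    fun ε hε => subset_convexHull ℝ _ ⟨ε, hε, rfl⟩
  let σ : (Fin n → ℝ) → ℝ := fun e => if 0 ≤ w ⬝ᵥ e then 1 else -1
  have hσ : ∀ e, σ e = 1 ∨ σ e = -1 := fun e => ite_eq_or_eq _ _ _
  have hσabs : ∀ e, σ e * (w ⬝ᵥ e) = |w ⬝ᵥ e| := by
    intro e
    by_cases h : 0 ≤ w ⬝ᵥ e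
    · simp [σ, h, abs_of_nonneg h]
    · simp [σ, h, abs_of_neg (not_le.1 h)]
  have hz_le : w ⬝ᵥ z ≤ ∑ e ∈ E, |w ⬝ᵥ e| := by
    refine dotProduct_le_of_mem_convexHull ?_ hz.1
    rintro _ ⟨ε, hε, rfl⟩
    rw [dotProduct_sum]
    refine Finset.sum_le_sum fun e _ => ?_
    rw [dotProduct_smul, smul_eq_mul]
    rcases hε e with h | h <;> rw [h]
    · simpa using le_abs_self _
    · simpa using neg_le_abs _
  have huniq : ∀ ε : (Fin n → ℝ) → ℝ, (∀ e, ε e = 1 ∨ ε e = -1) →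
      (∀ e, ε e * (w ⬝ᵥ e) = |w ⬝ᵥ e|) → ∑ e ∈ E, ε e • e = z := by
    intro ε hε habs
    by_contra hne
    have hlt := hz.2 _ (hmem ε hε) hne
    simp only [dotProduct_sum, dotProduct_smul, smul_eq_mul, habs] at hlt
    exact hlt.not_ge hz_le
  have key : ∀ s : ℝ, s = 1 ∨ s = -1 → s • g + ∑ e ∈ E.erase g, σ e • e = z := by
    intro s hs
    rw [← huniq (Function.update σ g s), ← Finset.add_sum_erase _ _ hg]
    · congr 1
      · simp
      · exact Finset.sum_congr rfl fun e he => by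
          rw [Function.update_of_ne (Finset.ne_of_mem_erase he)]
    · intro e
      rcases eq_or_ne e g with rfl | h
      · simpa using hs
      · simpa [h] using hσ e
    · intro e
      rcases eq_or_ne e g with rfl | h
      · simp [hwg]
      · simpa [h] using hσabs e
  have heq := (key 1 (.inl rfl)).trans (key (-1) (.inr rfl)).symm
  rw [add_left_inj, one_smul, neg_one_smul, self_eq_neg] at heq
  exact hg0 heq

/-- Proposition 2.1 (Refinement): the zonotope generated by a set covering all
edge-directions of a polytope `P` is a refinement of `P`: any functional with a unique
maximizer over the zonotope has a unique maximizer over `P`. -/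
theorem zonotope_refines {n : ℕ}
    (V : Finset (Fin n → ℝ)) (hV : V.Nonempty)
    (P : Set (Fin n → ℝ)) (hP : P = convexHull ℝ (V : Set (Fin n → ℝ)))
    (E : Finset (Fin n → ℝ))
    (hE : ∀ e : Set (Fin n → ℝ), IsEdge P e →
      ∃ g ∈ E, ∃ u ∈ e, ∃ v ∈ e, u ≠ v ∧ ∃ lam : ℝ, lam ≠ 0 ∧ g = lam • (u - v))
    (Z : Set (Fin n → ℝ)) (hZ : Z = zone E) :
    ∀ w : Fin n → ℝ, (∃ z, UniqueMax Z w z) → ∃ x, UniqueMax P w x := by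
  rintro w ⟨z, hz⟩
  subst hP hZ
  have hnt : ¬ (argmaxOn V w).Nontrivial := by
    intro hnt
    obtain ⟨e, he, hew⟩ := exists_isEdge_of_nontrivial hnt
    obtain ⟨g, hg, u, hu, v, hv, huv, r, hr, rfl⟩ := hE e he
    refine dotProduct_ne_zero_of_uniqueMax_zone hz hg (smul_ne_zero hr (sub_ne_zero.2 huv)) ?_
    obtain ⟨p, hp⟩ := hnt.nonempty
    have hconst : ∀ y ∈ (argmaxOn V w : Set (Fin n → ℝ)), w ⬝ᵥ y = w ⬝ᵥ p := fun y hy =>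
      le_antisymm ((mem_argmaxOn.1 hp).2 y (mem_argmaxOn.1 hy).1)
        ((mem_argmaxOn.1 hy).2 p (mem_argmaxOn.1 hp).1)
    rw [dotProduct_smul, dotProduct_sub, dotProduct_eq_of_mem_convexHull hconst (hew hu),
      dotProduct_eq_of_mem_convexHull hconst (hew hv), sub_self, smul_zero]
  obtain ⟨x, hx⟩ := argmaxOn_nonempty hV w
  have hxV := mem_argmaxOn.1 hx
  have hsing : (argmaxOn V w : Set (Fin n → ℝ)) = {x} :=
    (Set.not_nontrivial_iff.1 hnt).eq_singleton_of_mem hx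
  refine ⟨x, subset_convexHull ℝ _ hxV.1, fun y hy hne => ?_⟩
  by_contra! hle
  have := mem_convexHull_argmaxOn hy fun v hv => (hxV.2 v hv).trans hle
  rw [hsing, convexHull_singleton] at this
  exact hne this
end
end

section
/- Let P ⊂ ℝ^n be a polytope (the convex hull of a finite set), let E ⊂ ℝ^n be a finite set covering all edge-directions of P, and let Z = zone(E). Then for every vertex u of P there exist a vertex v of Z and a vector w ∈ ℝ^n such that w is uniquely maximized over Z at v and w is uniquely maximized over P at u. -/
open Matrix

noncomputable section

/-- A functional uniquely maximized over `S` at `v` is uniquely maximized there over the convex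
hull of `S`. -/
theorem UniqueMax.convexHull_of_generators {k : ℕ} {S : Set (Fin k → ℝ)} {w v : Fin k → ℝ}
    (h : UniqueMax S w v) : UniqueMax (convexHull ℝ S) w v := by
  refine ⟨subset_convexHull ℝ S h.1, ?_⟩
  have hconv : Convex ℝ {z : Fin k → ℝ | z ≠ v → w ⬝ᵥ z < w ⬝ᵥ v} := by
    have hle : ∀ z : Fin k → ℝ, (z ≠ v → w ⬝ᵥ z < w ⬝ᵥ v) → w ⬝ᵥ z ≤ w ⬝ᵥ v := by
      intro z hz
      rcases eq_or_ne z v with rfl | hzv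
      · exact le_rfl
      · exact (hz hzv).le
    rw [convex_iff_forall_pos]
    intro x hx y hy a b ha hb hab hne
    simp only [dotProduct_add, dotProduct_smul, smul_eq_mul]
    have hv : w ⬝ᵥ v = a * (w ⬝ᵥ v) + b * (w ⬝ᵥ v) := by rw [← add_mul, hab, one_mul]
    rw [hv]
    have hx' := mul_le_mul_of_nonneg_left (hle x hx) ha.le
    have hy' := mul_le_mul_of_nonneg_left (hle y hy) hb.le
    by_cases hxv : x = v
    · have hyv : y ≠ v := by
        rintro rfl
        exact hne (by rw [hxv, ← add_smul, hab, one_smul])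
      exact add_lt_add_of_le_of_lt hx' (mul_lt_mul_of_pos_left (hy hyv) hb)
    · exact add_lt_add_of_lt_of_le (mul_lt_mul_of_pos_left (hx hxv) ha) hy'
  exact fun z hz => convexHull_min (fun x hx => h.2 x hx) hconv hz

/-- A point at which a functional is uniquely maximized over a convex hull is one of the generating
points. -/
theorem UniqueMax.mem_generators {k : ℕ} {S : Set (Fin k → ℝ)} {w v : Fin k → ℝ}
    (h : UniqueMax (convexHull ℝ S) w v) : v ∈ S := by
  by_contra hv
  have hconv : Convex ℝ {z : Fin k → ℝ | w ⬝ᵥ z < w ⬝ᵥ v} :=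
    convex_halfSpace_lt ⟨dotProduct_add w, fun c x => dotProduct_smul c w x⟩ _
  have hsub : S ⊆ {z : Fin k → ℝ | w ⬝ᵥ z < w ⬝ᵥ v} := fun x hx =>
    h.2 x (subset_convexHull ℝ S hx) fun hxv => hv (hxv ▸ hx)
  exact lt_irrefl (w ⬝ᵥ v) (convexHull_min hsub hconv h.1)

/-- A functional positive on a finite set can be perturbed, staying positive there, so as not to
vanish at any nonzero vector of a second finite set. -/
theorem exists_dotProduct_pos_and_ne_zero {k : ℕ} (D E : Finset (Fin k → ℝ)) (w₀ : Fin k → ℝ)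
    (h₀ : ∀ d ∈ D, 0 < w₀ ⬝ᵥ d) :
    ∃ w : Fin k → ℝ, (∀ d ∈ D, 0 < w ⬝ᵥ d) ∧ ∀ e ∈ E, e ≠ 0 → w ⬝ᵥ e ≠ 0 := by
  classical
  induction E using Finset.induction_on with
  | empty => exact ⟨w₀, h₀, by simp⟩
  | insert e E _ ih =>
    obtain ⟨w, hD, hE⟩ := ih
    by_cases he : e ≠ 0 ∧ w ⬝ᵥ e = 0
    · have hlim : ∀ x : Fin k → ℝ, Filter.Tendsto (fun t : ℝ => (w + t • e) ⬝ᵥ x)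
          (nhdsWithin 0 (Set.Ioi 0)) (nhds (w ⬝ᵥ x)) := by
        intro x
        have hc : Continuous fun t : ℝ => w ⬝ᵥ x + t * (e ⬝ᵥ x) := by fun_prop
        simpa [add_dotProduct, smul_dotProduct] using
          (hc.tendsto 0).mono_left nhdsWithin_le_nhds
      have hD' : ∀ᶠ t : ℝ in nhdsWithin 0 (Set.Ioi 0), ∀ d ∈ D, 0 < (w + t • e) ⬝ᵥ d :=
        (Finset.eventually_all D).2 fun d hd => (hlim d).eventually_const_lt (hD d hd)
      have hE' : ∀ᶠ t : ℝ in nhdsWithin 0 (Set.Ioi 0),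
          ∀ x ∈ E, x ≠ 0 → (w + t • e) ⬝ᵥ x ≠ 0 := by
        refine (Finset.eventually_all E).2 fun x hx => ?_
        by_cases hx0 : x = 0
        · simp [hx0]
        · filter_upwards [(hlim x).eventually_ne (hE x hx hx0)] with t ht _ using ht
      obtain ⟨t, htD, htE, ht⟩ := (hD'.and (hE'.and self_mem_nhdsWithin)).exists
      refine ⟨w + t • e, htD, Finset.forall_mem_insert _ _ _ |>.2 ⟨fun he0 => ?_, htE⟩⟩
      rw [add_dotProduct, he.2, zero_add, smul_dotProduct, smul_eq_mul]
      exact mul_ne_zero (ne_of_gt ht) (dotProduct_self_eq_zero.not.2 he0)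
    · exact ⟨w, hD, Finset.forall_mem_insert _ _ _ |>.2 ⟨fun h0 h => he ⟨h0, h⟩, hE⟩⟩

/-- A functional vanishing at no nonzero generator is uniquely maximized over the zonotope. -/
theorem exists_uniqueMax_zone {k : ℕ} (E : Finset (Fin k → ℝ)) (w : Fin k → ℝ)
    (hw : ∀ e ∈ E, e ≠ 0 → w ⬝ᵥ e ≠ 0) : ∃ v, UniqueMax (zone E) w v := by
  set ε : (Fin k → ℝ) → ℝ := fun e => if 0 ≤ w ⬝ᵥ e then 1 else -1 with hε
  have hsign : ∀ e, ε e = 1 ∨ ε e = -1 := fun e => ite_eq_or_eq _ _ _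
  have habs : ∀ e, ε e * (w ⬝ᵥ e) = |w ⬝ᵥ e| := by
    intro e
    by_cases h : 0 ≤ w ⬝ᵥ e
    · simp [hε, h, abs_of_nonneg h]
    · simp [hε, h, abs_of_neg (not_le.1 h)]
  have hle : ∀ δ : ℝ, δ = 1 ∨ δ = -1 → ∀ e, δ * (w ⬝ᵥ e) ≤ ε e * (w ⬝ᵥ e) := by
    rintro δ (rfl | rfl) e
    · simpa [habs] using le_abs_self (w ⬝ᵥ e)
    · simpa [habs] using neg_le_abs (w ⬝ᵥ e)
  refine ⟨∑ e ∈ E, ε e • e, UniqueMax.convexHull_of_generators ⟨⟨ε, hsign, rfl⟩, ?_⟩⟩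
  rintro _ ⟨δ, hδ, rfl⟩ hne
  simp only [dotProduct_sum, dotProduct_smul, smul_eq_mul]
  obtain ⟨e, he, hee⟩ : ∃ e ∈ E, δ e • e ≠ ε e • e := by
    by_contra! h
    exact hne (Finset.sum_congr rfl h)
  have he0 : e ≠ 0 := by
    rintro rfl
    simp at hee
  refine Finset.sum_lt_sum (fun x _ => hle _ (hδ x) x)
    ⟨e, he, lt_of_le_of_ne (hle _ (hδ e) e) fun h => hee ?_⟩
  rw [mul_right_cancel₀ (hw e he he0) h]

/-- For every vertex `u` of `P` there are a vertex `v` of the zonotope `Z = zone E` and a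
functional `w` uniquely maximized over `Z` at `v` and uniquely maximized over `P` at `u`. -/
theorem vertices_of_P_from_zonotope {n : ℕ}
    (V : Finset (Fin n → ℝ))
    (P : Set (Fin n → ℝ)) (hP : P = convexHull ℝ (V : Set (Fin n → ℝ)))
    (E : Finset (Fin n → ℝ))
    (hE : ∀ e : Set (Fin n → ℝ), IsEdge P e →
      ∃ g ∈ E, ∃ u ∈ e, ∃ v ∈ e, u ≠ v ∧ ∃ lam : ℝ, lam ≠ 0 ∧ g = lam • (u - v))
    (Z : Set (Fin n → ℝ)) (hZ : Z = zone E) :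
    ∀ u : Fin n → ℝ, IsVertex P u →
      ∃ v : Fin n → ℝ, IsVertex Z v ∧ ∃ w : Fin n → ℝ, UniqueMax Z w v ∧ UniqueMax P w u := by
  classical
  subst hP hZ
  rintro u ⟨w₀, h₀⟩
  obtain ⟨w, hwV, hwE⟩ := exists_dotProduct_pos_and_ne_zero
    ((V.erase u).image fun x => u - x) E w₀ (by
      simp only [Finset.forall_mem_image, Finset.mem_erase, dotProduct_sub, sub_pos]
      exact fun x hx => h₀.2 x (subset_convexHull ℝ _ hx.2) hx.1)
  simp only [Finset.forall_mem_image, Finset.mem_erase, dotProduct_sub, sub_pos] at hwV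
  obtain ⟨v, hv⟩ := exists_uniqueMax_zone E w hwE
  exact ⟨v, ⟨w, hv⟩, w, hv,
    UniqueMax.convexHull_of_generators ⟨h₀.mem_generators, fun x hx hxu => hwV ⟨hxu, hx⟩⟩⟩
end
end

section
/- Let A ∈ ℤ^{m×n}, b ∈ ℤ^m, and let L = {x ∈ ℝ^n : x ≥ 0, Ax = b}. Then the set of circuits of A covers all edge-directions of L: for every edge e of L there exist a circuit g of A, two distinct points u, v ∈ e, and a nonzero scalar λ with u − v = λ g. -/
open Matrix

noncomputable section

/-- A circuit of `A`: a nonzero integer vector in the kernel of `A` with inclusion-minimal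
support and coprime entries. -/
def IsCircuit {m n : ℕ} (A : Matrix (Fin m) (Fin n) ℤ) (g : Fin n → ℤ) : Prop :=
  g ≠ 0 ∧ A.mulVec g = 0 ∧
    (∀ h : Fin n → ℤ, h ≠ 0 → A.mulVec h = 0 →
      {i | h i ≠ 0} ⊆ {i | g i ≠ 0} → {i | h i ≠ 0} = {i | g i ≠ 0}) ∧
    Finset.univ.gcd g = 1

/-- An integer matrix with a nontrivial real kernel has a nontrivial integer kernel. -/
theorem exists_int_mulVec_eq_zero_of_real {ι κ : Type*} [Fintype ι] [Fintype κ]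
    [DecidableEq κ] (B : Matrix ι κ ℤ) {d : κ → ℝ} (hd : d ≠ 0)
    (hBd : (B.map (Int.cast : ℤ → ℝ)).mulVec d = 0) :
    ∃ z : κ → ℤ, z ≠ 0 ∧ B.mulVec z = 0 := by
  have hreal : ((Bᵀ * B).map (Int.castRingHom ℝ)).det = 0 := by
    refine Matrix.exists_mulVec_eq_zero_iff.mp ⟨d, hd, ?_⟩
    rw [Matrix.map_mul, ← Matrix.mulVec_mulVec]
    have h : (B.map (Int.castRingHom ℝ)).mulVec d = 0 := hBd
    rw [h, Matrix.mulVec_zero]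
  have hint : (Bᵀ * B).det = 0 := by
    have h := (Int.castRingHom ℝ).map_det (Bᵀ * B)
    rw [RingHom.mapMatrix_apply, hreal] at h
    exact Int.cast_eq_zero.mp h
  obtain ⟨z, hz, hBz⟩ := Matrix.exists_mulVec_eq_zero_iff.mpr hint
  refine ⟨z, hz, dotProduct_self_eq_zero.mp ?_⟩
  rw [Matrix.dotProduct_mulVec, ← Matrix.mulVec_transpose, Matrix.mulVec_mulVec, hBz,
    zero_dotProduct]

/-- A vector supported on the support of a nonnegative vector `c` can be scaled so that its
entries are bounded by those of `c`. -/
theorem exists_pos_abs_mul_le {ι : Type*} [Finite ι] {c h : ι → ℝ} (hc : ∀ i, 0 ≤ c i)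
    (hh : ∀ i, c i = 0 → h i = 0) : ∃ ε : ℝ, 0 < ε ∧ ∀ i, |ε * h i| ≤ c i := by
  have hev : ∀ᶠ ε : ℝ in nhdsWithin 0 (Set.Ioi 0), ∀ i, |ε * h i| ≤ c i := by
    refine Filter.eventually_all.mpr fun i => ?_
    rcases (hc i).eq_or_lt with h0 | hpos
    · simp [hh i h0.symm, ← h0]
    · have hcont : ContinuousAt (fun ε : ℝ => |ε * h i|) 0 := by fun_prop
      have hlt : |(0 : ℝ) * h i| < c i := by simpa using hpos
      exact ((hcont.eventually_lt_const hlt).filter_mono nhdsWithin_le_nhds).mono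
        fun _ => le_of_lt
  obtain ⟨ε, h1, h2⟩ := (hev.and self_mem_nhdsWithin).exists
  exact ⟨ε, h2, h1⟩

/-- The face of `{x | 0 ≤ x, M x = b}` maximizing `w` contains in its linear direction space every
kernel vector supported on the support of one of its points. -/
theorem mem_vectorSpan_face {m n : ℕ} (M : Matrix (Fin m) (Fin n) ℝ) (b : Fin m → ℝ)
    (w : Fin n → ℝ) {L e : Set (Fin n → ℝ)} (hL : L = {x | (∀ i, 0 ≤ x i) ∧ M.mulVec x = b})
    (he : e = {x | x ∈ L ∧ ∀ y ∈ L, w ⬝ᵥ y ≤ w ⬝ᵥ x}) {c h : Fin n → ℝ} (hc : c ∈ e)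
    (hMh : M.mulVec h = 0) (hh : ∀ i, c i = 0 → h i = 0) : h ∈ vectorSpan ℝ e := by
  subst he
  have hcL := hc.1
  rw [hL] at hcL
  obtain ⟨ε, hε, hle⟩ := exists_pos_abs_mul_le hcL.1 hh
  have hplus : c + ε • h ∈ L := by
    rw [hL]
    refine ⟨fun i => ?_, by rw [mulVec_add, mulVec_smul, hMh, hcL.2, smul_zero, add_zero]⟩
    have := (abs_le.mp (hle i)).1
    simp only [Pi.add_apply, Pi.smul_apply, smul_eq_mul]
    linarith
  have hminus : c - ε • h ∈ L := by
    rw [hL]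
    refine ⟨fun i => ?_, by rw [mulVec_sub, mulVec_smul, hMh, hcL.2, smul_zero, sub_zero]⟩
    have := (abs_le.mp (hle i)).2
    simp only [Pi.sub_apply, Pi.smul_apply, smul_eq_mul]
    linarith
  have hmem : c + ε • h ∈ {x | x ∈ L ∧ ∀ y ∈ L, w ⬝ᵥ y ≤ w ⬝ᵥ x} := by
    refine ⟨hplus, fun y hy => ?_⟩
    have h1 := hc.2 y hy
    have h2 := hc.2 _ hminus
    rw [dotProduct_sub] at h2
    rw [dotProduct_add]
    linarith
  have hspan := vsub_mem_vectorSpan ℝ hmem hc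
  rw [vsub_eq_sub, add_sub_cancel_left] at hspan
  exact (Submodule.smul_mem_iff _ hε.ne').mp hspan

/-- A nonzero integer kernel vector of `A` such that all integer kernel vectors supported on a set
containing its support are real multiples of a fixed `d` yields a circuit that is a multiple
of `d`. -/
theorem exists_isCircuit_smul {m n : ℕ} (A : Matrix (Fin m) (Fin n) ℤ) (S : Set (Fin n))
    (d : Fin n → ℝ)
    (hd : ∀ z : Fin n → ℤ, A.mulVec z = 0 → (∀ i ∉ S, z i = 0) → ∃ t : ℝ, t • d = intCast z)
    {z : Fin n → ℤ} (hz : z ≠ 0) (hAz : A.mulVec z = 0) (hzS : ∀ i ∉ S, z i = 0) :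
    ∃ g : Fin n → ℤ, IsCircuit A g ∧ ∃ t : ℝ, t ≠ 0 ∧ t • d = intCast g := by
  have hne : ∀ {t : ℝ} {x : Fin n → ℤ}, t • d = intCast x → x ≠ 0 → t ≠ 0 := by
    rintro t x ht hx rfl
    refine hx (funext fun i => ?_)
    have := congrFun ht i
    simp only [zero_smul, Pi.zero_apply, intCast] at this
    exact_mod_cast this.symm
  have hsupp : ∀ {t : ℝ} {x : Fin n → ℤ}, t • d = intCast x → x ≠ 0 →
      {i | x i ≠ 0} = {i | d i ≠ 0} := by
    intro t x ht hx
    ext i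
    have h := congrFun ht i
    simp only [Pi.smul_apply, smul_eq_mul, intCast] at h
    have h' : (x i : ℝ) ≠ 0 ↔ d i ≠ 0 := by
      rw [← h, mul_ne_zero_iff, and_iff_right (hne ht hx)]
    simpa using h'
  obtain ⟨j, hj⟩ := Function.ne_iff.mp hz
  obtain ⟨g, hzg, hgcd⟩ := Finset.extract_gcd z ⟨j, Finset.mem_univ j⟩
  set k := Finset.univ.gcd z
  have hzg' : z = k • g := funext fun i => hzg i (Finset.mem_univ i)
  have hk : k ≠ 0 := by
    intro hk
    exact hz (by rw [hzg', hk, zero_smul])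
  have hg : g ≠ 0 := by
    intro hg
    exact hz (by rw [hzg', hg, smul_zero])
  have hAg : A.mulVec g = 0 := by
    rw [hzg', mulVec_smul] at hAz
    exact (smul_eq_zero.mp hAz).resolve_left hk
  have hgS : ∀ i ∉ S, g i = 0 := fun i hi =>
    (mul_eq_zero.mp ((hzg i (Finset.mem_univ i)).symm.trans (hzS i hi))).resolve_left hk
  obtain ⟨t, ht⟩ := hd g hAg hgS
  refine ⟨g, ⟨hg, hAg, fun h hh hAh hsub => ?_, hgcd⟩, t, hne ht hg, ht⟩
  obtain ⟨s, hs⟩ := hd h hAh fun i hi => by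
    by_contra hi'
    exact hsub hi' (hgS i hi)
  rw [hsupp hs hh, hsupp ht hg]

/-- The circuits of `A` cover all edge-directions of the polyhedron
`L = {x ∈ ℝ^n : x ≥ 0, Ax = b}`. -/
theorem circuits_cover_edge_directions {m n : ℕ}
    (A : Matrix (Fin m) (Fin n) ℤ) (b : Fin m → ℤ)
    (L : Set (Fin n → ℝ))
    (hL : L = {x : Fin n → ℝ | (∀ i, 0 ≤ x i) ∧
      (A.map (Int.cast : ℤ → ℝ)).mulVec x = fun i => (b i : ℝ)}) :
    ∀ e : Set (Fin n → ℝ), IsEdge L e →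
      ∃ g : Fin n → ℤ, IsCircuit A g ∧ ∃ u ∈ e, ∃ v ∈ e, u ≠ v ∧
        ∃ lam : ℝ, lam ≠ 0 ∧ u - v = lam • intCast g := by
  classical
  rintro e ⟨⟨w, he⟩, hrank⟩
  obtain ⟨u, hu, v, hv, huv⟩ : e.Nontrivial := by
    rw [← Set.not_subsingleton_iff]
    intro hs
    rw [(vectorSpan_of_subsingleton ℝ hs), finrank_bot] at hrank
    exact zero_ne_one hrank
  have hd : u - v ≠ 0 := sub_ne_zero.mpr huv
  have hconv : Convex ℝ L := by
    rw [hL]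
    intro x hx y hy s t hs ht hst
    refine ⟨fun i => add_nonneg (mul_nonneg hs (hx.1 i)) (mul_nonneg ht (hy.1 i)), ?_⟩
    rw [mulVec_add, mulVec_smul, mulVec_smul, hx.2, hy.2, ← add_smul, hst, one_smul]
  have huE := hu
  have hvE := hv
  rw [he] at huE hvE
  obtain ⟨huL, huw⟩ := huE
  obtain ⟨hvL, hvw⟩ := hvE
  set c : Fin n → ℝ := (1 / 2 : ℝ) • u + (1 / 2 : ℝ) • v with hc
  have hcE : c ∈ e := by
    rw [he]
    refine ⟨hconv huL hvL (by norm_num) (by norm_num) (by norm_num), fun y hy => ?_⟩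
    have h1 := huw y hy
    have h2 := hvw y hy
    rw [hc, dotProduct_add, dotProduct_smul, dotProduct_smul, smul_eq_mul, smul_eq_mul]
    linarith
  rw [hL] at huL hvL
  have hdsupp : ∀ i, c i = 0 → (u - v) i = 0 := by
    intro i hi
    have h1 := huL.1 i
    have h2 := hvL.1 i
    simp only [hc, Pi.add_apply, Pi.smul_apply, smul_eq_mul] at hi
    rw [Pi.sub_apply]
    linarith
  have hmult : ∀ z : Fin n → ℤ, A.mulVec z = 0 → (∀ i ∉ {i | c i ≠ 0}, z i = 0) →
      ∃ t : ℝ, t • (u - v) = intCast z := by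
    intro z hAz hz
    have hker : (A.map (Int.cast : ℤ → ℝ)).mulVec (intCast z) = 0 := by
      funext i
      have h := (Int.castRingHom ℝ).map_mulVec A z i
      rw [hAz] at h
      exact h.symm.trans (map_zero _)
    have hmem := mem_vectorSpan_face _ _ w hL he hcE hker fun i hi => by
      simp [intCast, hz i (by simpa using hi)]
    obtain ⟨t, ht⟩ := exists_smul_eq_of_finrank_eq_one hrank
      (x := ⟨u - v, vsub_mem_vectorSpan ℝ hu hv⟩) (by simpa using hd) ⟨_, hmem⟩
    exact ⟨t, congrArg Subtype.val ht⟩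
  obtain ⟨z, hz, hBz⟩ := exists_int_mulVec_eq_zero_of_real
    (fromRows A (diagonal fun i => if c i = 0 then (1 : ℤ) else 0)) hd (by
      rw [fromRows_map, fromRows_mulVec, mulVec_sub, huL.2, hvL.2, sub_self]
      rw [diagonal_map Int.cast_zero]
      ext (i | i)
      · rfl
      · rw [Sum.elim_inr, mulVec_diagonal]
        by_cases hi : c i = 0
        · rw [hdsupp i hi, mul_zero]; rfl
        · simp [hi])
  rw [fromRows_mulVec] at hBz
  have hAz : A.mulVec z = 0 := funext fun i => congrFun hBz (Sum.inl i)
  have hzS : ∀ i ∉ {i | c i ≠ 0}, z i = 0 := by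
    intro i hi
    have hi' : c i = 0 := by simpa using hi
    have h := congrFun hBz (Sum.inr i)
    simpa [mulVec_diagonal, hi'] using h
  obtain ⟨g, hg, t, ht, htg⟩ := exists_isCircuit_smul A _ _ hmult hz hAz hzS
  exact ⟨g, hg, u, hu, v, hv, huv, t⁻¹, inv_ne_zero ht, by rw [← htg, inv_smul_smul₀ ht]⟩
end
end
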